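/- The third homotopy group of the compact symplectic group Sp(4), based at the identity matrix, is infinite cyclic: there is a group isomorphism π₃(Sp(4), 1) ≅ ℤ. -/

import Mathlib

open scoped Topology

/-- The compact symplectic group `Sp(n)`: the group of unitary `n × n` matrices over the
real quaternions, i.e. matrices `A` with `A * Aᴴ = 1`. -/
abbrev Sp (n : ℕ) : Type :=
  unitary (Matrix (Fin n) (Fin n) (Quaternion ℝ))

open scoped unitInterval Quaternion

namespace GenLoop

variable {N X Y G : Type*} [TopologicalSpace X] [TopologicalSpace Y]

/-- Postcomposition of a generalized loop with a continuous map. -/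
def map {x : X} {y : Y} (f : C(X, Y)) (h : f x = y) (p : GenLoop N X x) : GenLoop N Y y :=
  ⟨f.comp p.1, fun t ht ↦ (congrArg f (p.2 t ht)).trans h⟩

@[simp]
theorem map_apply {x : X} {y : Y} (f : C(X, Y)) (h : f x = y) (p : GenLoop N X x) (t : N → I) :
    map f h p t = f (p t) := rfl

theorem Homotopic.map {x : X} {y : Y} (f : C(X, Y)) (h : f x = y) {p q : GenLoop N X x}
    (H : Homotopic p q) : Homotopic (map f h p) (map f h q) :=
  ContinuousMap.HomotopicRel.comp_continuousMap H f

variable [TopologicalSpace G] [Group G] [IsTopologicalGroup G]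

/-- The pointwise product of generalized loops in a topological group. -/
def pointwiseMul (f g : GenLoop N G 1) : GenLoop N G 1 :=
  ⟨f.1 * g.1, fun y hy ↦ by
    change f.1 y * g.1 y = 1
    rw [f.2 y hy, g.2 y hy, one_mul]⟩

theorem pointwiseMul_apply (f g : GenLoop N G 1) (t : N → I) :
    pointwiseMul f g t = f t * g t := rfl

theorem Homotopic.pointwiseMul {f f' g g' : GenLoop N G 1} (hf : Homotopic f f')
    (hg : Homotopic g g') : Homotopic (pointwiseMul f g) (pointwiseMul f' g') := by
  obtain ⟨F⟩ := hf
  obtain ⟨K⟩ := hg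
  refine ⟨⟨⟨⟨fun t ↦ F t * K t, by fun_prop⟩, fun x ↦ ?_, fun x ↦ ?_⟩, fun t x hx ↦ ?_⟩⟩
  · simp [GenLoop.pointwiseMul]
  · simp [GenLoop.pointwiseMul]
  · have h1 := F.eq_fst t hx
    have h2 := K.eq_fst t hx
    simp [GenLoop.pointwiseMul, h1, h2]

end GenLoop

namespace HomotopyGroup

open GenLoop

variable {N X Y G H : Type*} [TopologicalSpace X] [TopologicalSpace Y] [DecidableEq N]
variable [TopologicalSpace G] [Group G] [IsTopologicalGroup G]

/-- The class of a generalized loop in the homotopy group. -/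
def mk {x : X} (p : GenLoop N X x) : HomotopyGroup N X x := Quotient.mk _ p

theorem mk_mul_mk [Nonempty N] {x : X} (i : N) (p q : GenLoop N X x) :
    mk p * mk q = mk (transAt i q p) := mul_spec

theorem mk_pointwiseMul [Nonempty N] (f g : GenLoop N G 1) :
    mk (pointwiseMul f g) = mk f * mk g := by
  let i : N := Classical.arbitrary N
  have h1 : mk (transAt i const f) = mk f := (mk_mul_mk i f const).symm.trans (mul_one _)
  have h2 : mk (transAt i g const) = mk g := (mk_mul_mk i const g).symm.trans (one_mul _)
  have h3 : pointwiseMul (transAt i const f) (transAt i g const) = transAt i g f := by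
    ext t
    simp only [pointwiseMul_apply, transAt, coe_copy]
    split_ifs <;> simp
  refine Eq.trans ?_ (mk_mul_mk i f g).symm
  rw [← h3]
  exact Quotient.sound (Homotopic.pointwiseMul (Quotient.exact h1).symm (Quotient.exact h2).symm)

/-- The homomorphism of homotopy groups induced by a continuous map. -/
def map [Nonempty N] {x : X} {y : Y} (f : C(X, Y)) (h : f x = y) :
    HomotopyGroup N X x →* HomotopyGroup N Y y where
  toFun := Quotient.map (GenLoop.map f h) fun _ _ H ↦ Homotopic.map f h H
  map_one' := by
    rw [one_def, one_def]
    exact congrArg _ (GenLoop.ext _ _ fun t ↦ h)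
  map_mul' := by
    rintro ⟨p⟩ ⟨q⟩
    refine (congrArg _ (mul_spec (i := Classical.arbitrary N) (p := p) (q := q))).trans ?_
    refine Eq.trans ?_ (mul_spec (i := Classical.arbitrary N)).symm
    refine congrArg (Quotient.mk _) (GenLoop.ext _ _ fun t ↦ ?_)
    simp only [map_apply, transAt, coe_copy]
    split_ifs <;> rfl

theorem map_mk [Nonempty N] {x : X} {y : Y} (f : C(X, Y)) (h : f x = y) (p : GenLoop N X x) :
    map f h (mk p) = mk (GenLoop.map f h p) := rfl

end HomotopyGroup

/-- A continuous map on `ℝ^N` which is `1` outside the open unit cube. -/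
def CubeSupported {N G : Type*} [TopologicalSpace G] [One G] (F : (N → ℝ) → G) : Prop :=
  Continuous F ∧ ∀ x, (∃ i, x i ≤ 0 ∨ 1 ≤ x i) → F x = 1

namespace CubeSupported

open GenLoop

variable {N G : Type*} [TopologicalSpace G] [Group G]

/-- The generalized loop given by restriction to the unit cube. -/
def toGenLoop {F : (N → ℝ) → G} (hF : CubeSupported F) : GenLoop N G 1 :=
  ⟨⟨fun y ↦ F fun i ↦ y i, hF.1.comp (by fun_prop)⟩, fun y ⟨i, hi⟩ ↦ hF.2 _ ⟨i, by
    rcases hi with hi | hi <;> simp [hi]⟩⟩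

theorem one : CubeSupported (1 : (N → ℝ) → G) := ⟨continuous_const, fun _ _ ↦ rfl⟩

theorem mul [IsTopologicalGroup G] {F F' : (N → ℝ) → G} (hF : CubeSupported F)
    (hF' : CubeSupported F') : CubeSupported (F * F') :=
  ⟨hF.1.mul hF'.1, fun x hx ↦ by simp [hF.2 x hx, hF'.2 x hx]⟩

end CubeSupported

section cubeClamp

variable {N : Type*}

/-- The coordinatewise projection of `ℝ^N` onto the unit cube. -/
noncomputable def cubeClamp (x : N → ℝ) : N → I := fun i ↦ Set.projIcc 0 1 zero_le_one (x i)

theorem continuous_cubeClamp : Continuous (cubeClamp : (N → ℝ) → N → I) :=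
  continuous_pi fun i ↦ continuous_projIcc.comp (continuous_apply i)

theorem cubeClamp_coe (y : N → I) : cubeClamp (fun i ↦ (y i : ℝ)) = y :=
  funext fun i ↦ Set.projIcc_val _ (y i)

theorem cubeClamp_mem_boundary {x : N → ℝ} (hx : ∃ i, x i ≤ 0 ∨ 1 ≤ x i) :
    cubeClamp x ∈ Cube.boundary N := by
  obtain ⟨i, hi⟩ := hx
  refine ⟨i, hi.imp (fun h ↦ ?_) fun h ↦ ?_⟩
  · exact Set.projIcc_of_le_left _ h
  · exact Set.projIcc_of_right_le _ h

theorem GenLoop.cubeSupported {G : Type*} [TopologicalSpace G] [Group G] (p : GenLoop N G 1) :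
    CubeSupported fun x ↦ p (cubeClamp x) :=
  ⟨p.1.continuous.comp continuous_cubeClamp, fun _ hx ↦ p.2 _ (cubeClamp_mem_boundary hx)⟩

end cubeClamp

open Classical in
/-- The class in the homotopy group of a map supported in the unit cube (and `1` for other maps). -/
noncomputable def cubeClass {N G : Type*} [TopologicalSpace G] [Group G] [DecidableEq N]
    [Nonempty N] (F : (N → ℝ) → G) : HomotopyGroup N G 1 :=
  if hF : CubeSupported F then HomotopyGroup.mk hF.toGenLoop else 1

section cubeClass

open GenLoop

variable {N G : Type*} [TopologicalSpace G] [Group G] [DecidableEq N] [Nonempty N]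

theorem cubeClass_eq {F : (N → ℝ) → G} (hF : CubeSupported F) :
    cubeClass F = HomotopyGroup.mk hF.toGenLoop := dif_pos hF

theorem cubeClass_one : cubeClass (1 : (N → ℝ) → G) = 1 := cubeClass_eq .one

theorem cubeClass_mul [IsTopologicalGroup G] {F F' : (N → ℝ) → G} (hF : CubeSupported F)
    (hF' : CubeSupported F') : cubeClass (F * F') = cubeClass F * cubeClass F' := by
  rw [cubeClass_eq hF, cubeClass_eq hF', cubeClass_eq (hF.mul hF'),
    ← HomotopyGroup.mk_pointwiseMul]
  rfl

/-- Homotopies through maps supported in the unit cube preserve the class. -/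
theorem cubeClass_eq_of_homotopy (H : I → (N → ℝ) → G)
    (hc : Continuous fun z : I × (N → ℝ) ↦ H z.1 z.2)
    (hb : ∀ t x, (∃ i, x i ≤ 0 ∨ 1 ≤ x i) → H t x = 1) :
    cubeClass (H 0) = cubeClass (H 1) := by
  have hs (t : I) : CubeSupported (H t) := ⟨hc.comp (Continuous.prodMk_right t), hb t⟩
  rw [cubeClass_eq (hs 0), cubeClass_eq (hs 1)]
  have hc' : Continuous fun z : I × (N → I) ↦ H z.1 fun i ↦ z.2 i :=
    hc.comp (by fun_prop : Continuous fun z : I × (N → I) ↦ (z.1, fun i ↦ (z.2 i : ℝ)))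
  refine Quotient.sound ⟨⟨⟨⟨fun z ↦ H z.1 fun i ↦ z.2 i, hc'⟩,
    fun x ↦ rfl, fun x ↦ rfl⟩, fun t x hx ↦ ?_⟩⟩
  exact ((hs t).toGenLoop.2 x hx).trans ((hs 0).toGenLoop.2 x hx).symm

theorem exists_cubeClass_eq (c : HomotopyGroup N G 1) :
    ∃ F : (N → ℝ) → G, CubeSupported F ∧ cubeClass F = c := by
  induction c using Quotient.inductionOn with
  | h p =>
    refine ⟨_, GenLoop.cubeSupported p, (cubeClass_eq (GenLoop.cubeSupported p)).trans
      (congrArg _ ?_)⟩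
    exact GenLoop.ext _ _ fun y ↦ congrArg p (cubeClamp_coe y)

/-- Reversing one coordinate inverts the class. -/
theorem cubeClass_reflect (i : N) {F : (N → ℝ) → G} (hF : CubeSupported F) :
    cubeClass (fun x ↦ F fun j ↦ if j = i then 1 - x i else x j) = (cubeClass F)⁻¹ := by
  have h : CubeSupported (fun x ↦ F fun j ↦ if j = i then 1 - x i else x j) := by
    refine ⟨hF.1.comp (continuous_pi fun j ↦ ?_), fun x ⟨k, hk⟩ ↦ hF.2 _ ⟨k, ?_⟩⟩
    · split_ifs <;> fun_prop
    · split_ifs with hki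
      · subst hki
        rcases hk with hk | hk
        · right; linarith
        · left; linarith
      · exact hk
  rw [cubeClass_eq hF, cubeClass_eq h]
  refine Eq.trans ?_ (HomotopyGroup.inv_spec (i := i)).symm
  refine congrArg (Quotient.mk _) (GenLoop.ext _ _ fun y ↦ ?_)
  change F _ = F _
  congr 1
  ext j
  dsimp only
  split_ifs <;> simp

end cubeClass

section QuaternionicRotation

open Matrix

variable {ι : Type*}

/-- The matrix `w c w^*`. -/
noncomputable def outer (w : ι → ℍ) (c : ℍ) : Matrix ι ι ℍ :=
  Matrix.of fun i j ↦ w i * c * star (w j)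

theorem conjTranspose_outer (w : ι → ℍ) (c : ℍ) : star (outer w c) = outer w (star c) := by
  ext1 i j
  simp [outer, star_apply, mul_assoc]

theorem outer_add (w : ι → ℍ) (c d : ℍ) : outer w (c + d) = outer w c + outer w d := by
  ext1 i j
  simp only [outer, of_apply, Matrix.add_apply]
  rw [mul_add, add_mul]

theorem outer_neg (w : ι → ℍ) (c : ℍ) : outer (-w) c = outer w c := by
  ext1 i j
  simp [outer]

variable [Fintype ι]

theorem star_star_dotProduct (u v : ι → ℍ) : star (star v ⬝ᵥ u) = star u ⬝ᵥ v := by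
  rw [star_dotProduct, star_star]

/-- The squared Euclidean norm of a quaternionic vector. -/
noncomputable def sqNorm (u : ι → ℍ) : ℝ := ∑ i, ‖u i‖ ^ 2

theorem star_dotProduct_self (u : ι → ℍ) : star u ⬝ᵥ u = (sqNorm u : ℍ) := by
  simp only [dotProduct, sqNorm, Pi.star_apply, Quaternion.star_mul_self]
  rw [← Quaternion.algebraMap_def, map_sum]
  exact Finset.sum_congr rfl fun i _ ↦ by rw [Quaternion.normSq_eq_norm_mul_self, sq]

theorem sqNorm_eq_zero {u : ι → ℍ} : sqNorm u = 0 ↔ u = 0 := by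
  rw [sqNorm, Finset.sum_eq_zero_iff_of_nonneg fun i _ ↦ by positivity]
  simp [funext_iff]

theorem sqNorm_nonneg (u : ι → ℍ) : 0 ≤ sqNorm u := Finset.sum_nonneg fun i _ ↦ by positivity

theorem sqNorm_pos {u : ι → ℍ} (hu : u ≠ 0) : 0 < sqNorm u :=
  (sqNorm_nonneg u).lt_of_ne fun h ↦ hu (sqNorm_eq_zero.1 h.symm)

theorem sqNorm_smul (r : ℝ) (u : ι → ℍ) : sqNorm (r • u) = r ^ 2 * sqNorm u := by
  simp [sqNorm, norm_smul, mul_pow, Finset.mul_sum]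

theorem sqNorm_neg (u : ι → ℍ) : sqNorm (-u) = sqNorm u := by simp [sqNorm]

theorem continuous_sqNorm : Continuous (sqNorm : (ι → ℍ) → ℝ) := by
  unfold sqNorm; fun_prop

theorem sqNorm_single [DecidableEq ι] (i : ι) : sqNorm (Pi.single i 1 : ι → ℍ) = 1 := by
  rw [sqNorm, Finset.sum_eq_single i] <;> simp +contextual

/-- The unit vector in the direction of a nonzero quaternionic vector. -/
noncomputable def unitVec (u : ι → ℍ) : ι → ℍ := (√(sqNorm u))⁻¹ • u

theorem sqNorm_unitVec {u : ι → ℍ} (hu : u ≠ 0) : sqNorm (unitVec u) = 1 := by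
  have := sqNorm_pos hu
  rw [unitVec, sqNorm_smul, inv_pow, Real.sq_sqrt this.le, inv_mul_cancel₀ this.ne']

theorem unitVec_of_sqNorm_eq_one {u : ι → ℍ} (hu : sqNorm u = 1) : unitVec u = u := by
  simp [unitVec, hu]

theorem unitVec_apply_eq_zero {u : ι → ℍ} {i : ι} (h : u i = 0) : unitVec u i = 0 := by
  simp [unitVec, h]

theorem continuous_unitVec {X : Type*} [TopologicalSpace X] {u : X → ι → ℍ} (hu : Continuous u)
    (h : ∀ x, u x ≠ 0) : Continuous fun x ↦ unitVec (u x) := by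
  have h1 : Continuous fun x ↦ √(sqNorm (u x)) :=
    Real.continuous_sqrt.comp (continuous_sqNorm.comp hu)
  exact (h1.inv₀ fun x ↦ (Real.sqrt_pos.2 (sqNorm_pos (h x))).ne').smul hu

theorem ne_zero_of_sqNorm_eq_one {u : ι → ℍ} (hu : sqNorm u = 1) : u ≠ 0 := by
  rintro rfl
  simp [sqNorm] at hu

theorem ne_neg_self_of_sqNorm_eq_one {u : ι → ℍ} (hu : sqNorm u = 1) : u ≠ -u := fun h ↦ by
  have h2 : (2 : ℝ) • u = 0 := by rw [two_smul]; nth_rw 2 [h]; exact add_neg_cancel u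
  exact ne_zero_of_sqNorm_eq_one hu ((smul_eq_zero.1 h2).resolve_left two_ne_zero)

theorem eq_of_smul_eq_smul {u v : ι → ℍ} (hu : sqNorm u = 1) (hv : sqNorm v = 1) {r s : ℝ}
    (hr : 0 ≤ r) (hs : 0 ≤ s) (hrs : r ≠ 0 ∨ s ≠ 0) (h : r • u = s • v) : u = v := by
  have h2 := congrArg sqNorm h
  rw [sqNorm_smul, sqNorm_smul, hu, hv, mul_one, mul_one, sq_eq_sq₀ hr hs] at h2
  subst h2
  exact smul_right_injective _ (by tauto) h

theorem outer_mul_outer (w : ι → ℍ) (c d : ℍ) :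
    outer w c * outer w d = outer w (c * (star w ⬝ᵥ w) * d) := by
  ext1 i j
  simp only [outer, Matrix.mul_apply, of_apply, dotProduct, Finset.mul_sum, Finset.sum_mul,
    Pi.star_apply]
  exact Finset.sum_congr rfl fun k _ ↦ by noncomm_ring

theorem outer_mulVec (w : ι → ℍ) (c : ℍ) (u : ι → ℍ) :
    outer w c *ᵥ u = fun i ↦ w i * (c * (star w ⬝ᵥ u)) := by
  ext1 i
  simp only [outer, mulVec, of_apply, dotProduct, Finset.mul_sum, Pi.star_apply]
  exact Finset.sum_congr rfl fun k _ ↦ by noncomm_ring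

theorem star_sub_dotProduct_sub {u v : ι → ℍ} (hu : sqNorm u = 1) (hv : sqNorm v = 1) :
    star (u - v) ⬝ᵥ (u - v) = (1 - star v ⬝ᵥ u) + star (1 - star v ⬝ᵥ u) := by
  rw [star_sub (1 : ℍ), star_star_dotProduct, star_sub, sub_dotProduct, dotProduct_sub,
    dotProduct_sub, star_dotProduct_self, star_dotProduct_self, hu, hv]
  simp only [star_one, Quaternion.coe_one]
  abel

theorem one_sub_ne_zero {u v : ι → ℍ} (hu : sqNorm u = 1) (hv : sqNorm v = 1) (huv : u ≠ v) :
    1 - star v ⬝ᵥ u ≠ 0 := fun h ↦ by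
  have h2 := star_sub_dotProduct_sub hu hv
  rw [h, star_zero, add_zero, star_dotProduct_self] at h2
  exact huv (sub_eq_zero.1 (sqNorm_eq_zero.1 (congrArg QuaternionAlgebra.re h2)))

variable [DecidableEq ι]

/-- The quaternionic reflection taking the unit vector `u` to the unit vector `v ≠ u`. -/
noncomputable def quatReflection (u v : ι → ℍ) : Matrix ι ι ℍ :=
  1 - outer (u - v) (1 - star v ⬝ᵥ u)⁻¹

theorem star_quatReflection (u v : ι → ℍ) : star (quatReflection u v) = quatReflection v u := by
  rw [quatReflection, quatReflection, star_sub, star_one, conjTranspose_outer, ← outer_neg (v - u),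
    neg_sub, star_inv₀, star_sub, star_one, star_star_dotProduct]

theorem quatReflection_mul_star {u v : ι → ℍ} (hu : sqNorm u = 1) (hv : sqNorm v = 1)
    (huv : u ≠ v) : quatReflection u v * star (quatReflection u v) = 1 := by
  have ha := one_sub_ne_zero hu hv huv
  set a := 1 - star v ⬝ᵥ u with ha'
  have ha2 : star a ≠ 0 := by simpa using ha
  have key : a⁻¹ * (star (u - v) ⬝ᵥ (u - v)) * star a⁻¹ = a⁻¹ + star a⁻¹ := by
    rw [star_sub_dotProduct_sub hu hv, ← ha', mul_add, add_mul, star_inv₀, inv_mul_cancel₀ ha,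
      mul_assoc, mul_inv_cancel₀ ha2, one_mul, mul_one, add_comm]
  rw [quatReflection, ← ha', star_sub, star_one, conjTranspose_outer, sub_mul, mul_sub, mul_sub,
    one_mul, mul_one, one_mul, outer_mul_outer, key, outer_add]
  abel

theorem quatReflection_mem {u v : ι → ℍ} (hu : sqNorm u = 1) (hv : sqNorm v = 1) (huv : u ≠ v) :
    quatReflection u v ∈ unitary (Matrix ι ι ℍ) := by
  refine Unitary.mem_iff.2 ⟨?_, quatReflection_mul_star hu hv huv⟩
  have := quatReflection_mul_star hv hu huv.symm
  rwa [star_quatReflection, ← star_quatReflection] at this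

theorem quatReflection_mulVec {u v : ι → ℍ} (hu : sqNorm u = 1) (hv : sqNorm v = 1)
    (huv : u ≠ v) : quatReflection u v *ᵥ u = v := by
  have ha := one_sub_ne_zero hu hv huv
  have : star (u - v) ⬝ᵥ u = 1 - star v ⬝ᵥ u := by
    rw [star_sub, sub_dotProduct, star_dotProduct_self, hu, Quaternion.coe_one]
  rw [quatReflection, sub_mulVec, one_mulVec, outer_mulVec, this, inv_mul_cancel₀ ha]
  ext1 i
  simp

theorem quatReflection_mulVec_single {u v : ι → ℍ} {j : ι} (hu : u j = 0) (hv : v j = 0) :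
    quatReflection u v *ᵥ Pi.single j 1 = Pi.single j 1 := by
  rw [quatReflection, sub_mulVec, one_mulVec, outer_mulVec]
  ext1 i
  simp [hu, hv]

theorem continuous_quatReflection {X : Type*} [TopologicalSpace X] {u v : X → ι → ℍ}
    (hu : Continuous u) (hv : Continuous v) (h : ∀ x, 1 - star (v x) ⬝ᵥ u x ≠ 0) :
    Continuous fun x ↦ quatReflection (u x) (v x) := by
  have h1 : Continuous fun x ↦ (1 - star (v x) ⬝ᵥ u x)⁻¹ := by
    refine Continuous.inv₀ ?_ h
    simp only [dotProduct, Pi.star_apply]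
    fun_prop
  refine continuous_const.sub (continuous_matrix fun i j ↦ ?_)
  simp only [outer, of_apply, Pi.sub_apply]
  fun_prop

open Classical in
/-- A unitary matrix taking the unit vector `u` to the unit vector `v ≠ -u`, depending
continuously on `u` and `v`, with value `1` for `u = v`. -/
noncomputable def quatRotation (u v : ι → ℍ) : unitary (Matrix ι ι ℍ) :=
  if h : sqNorm u = 1 ∧ sqNorm v = 1 ∧ v ≠ -u then
    ⟨quatReflection (-u) v * quatReflection u (-u), mul_mem
      (quatReflection_mem ((sqNorm_neg u).trans h.1) h.2.1 h.2.2.symm)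
      (quatReflection_mem h.1 ((sqNorm_neg u).trans h.1)
        (ne_neg_self_of_sqNorm_eq_one h.1))⟩
  else 1

theorem coe_quatRotation {u v : ι → ℍ} (hu : sqNorm u = 1) (hv : sqNorm v = 1) (h : v ≠ -u) :
    (quatRotation u v : Matrix ι ι ℍ) = quatReflection (-u) v * quatReflection u (-u) := by
  rw [quatRotation, dif_pos ⟨hu, hv, h⟩]

theorem quatRotation_mulVec {u v : ι → ℍ} (hu : sqNorm u = 1) (hv : sqNorm v = 1) (h : v ≠ -u) :
    (quatRotation u v : Matrix ι ι ℍ) *ᵥ u = v := by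
  have hu' : sqNorm (-u) = 1 := (sqNorm_neg u).trans hu
  rw [coe_quatRotation hu hv h, ← mulVec_mulVec, quatReflection_mulVec hu hu'
    (ne_neg_self_of_sqNorm_eq_one hu), quatReflection_mulVec hu' hv h.symm]

theorem quatRotation_self {u : ι → ℍ} (hu : sqNorm u = 1) : quatRotation u u = 1 := by
  have h := ne_neg_self_of_sqNorm_eq_one hu
  have hu' : sqNorm (-u) = 1 := (sqNorm_neg u).trans hu
  refine Subtype.ext ?_
  rw [coe_quatRotation hu hu h, ← star_quatReflection]
  exact (Unitary.mem_iff.1 (quatReflection_mem hu hu' h)).1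

theorem quatRotation_mulVec_single {u v : ι → ℍ} {j : ι} (hu : u j = 0) (hv : v j = 0) :
    (quatRotation u v : Matrix ι ι ℍ) *ᵥ Pi.single j 1 = Pi.single j 1 := by
  rw [quatRotation]
  split_ifs with h
  · have hu' : (-u) j = 0 := by simp [hu]
    simp only
    rw [← mulVec_mulVec, quatReflection_mulVec_single hu hu', quatReflection_mulVec_single hu' hv]
  · rw [OneMemClass.coe_one, one_mulVec]

theorem continuous_quatRotation {X : Type*} [TopologicalSpace X] {u v : X → ι → ℍ}
    (hu : Continuous u) (hv : Continuous v) (hu1 : ∀ x, sqNorm (u x) = 1)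
    (hv1 : ∀ x, sqNorm (v x) = 1) (h : ∀ x, v x ≠ -u x) :
    Continuous fun x ↦ quatRotation (u x) (v x) := by
  refine continuous_induced_rng.2 ?_
  have heq : (Subtype.val ∘ fun x ↦ quatRotation (u x) (v x)) =
      fun x ↦ quatReflection (-u x) (v x) * quatReflection (u x) (-u x) :=
    funext fun x ↦ coe_quatRotation (hu1 x) (hv1 x) (h x)
  rw [heq]
  have hn (x) : sqNorm (-u x) = 1 := (sqNorm_neg _).trans (hu1 x)
  exact (continuous_quatReflection hu.neg hv fun x ↦
      one_sub_ne_zero (hn x) (hv1 x) (h x).symm).mul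
    (continuous_quatReflection hu hu.neg fun x ↦ one_sub_ne_zero (hu1 x) (hn x)
      (ne_neg_self_of_sqNorm_eq_one (hu1 x)))

end QuaternionicRotation

section Slerp

variable {ι : Type*} [Fintype ι]

/-- The point of parameter `t` on the normalised segment joining two unit vectors. -/
noncomputable def slerp (u v : ι → ℍ) (t : ℝ) : ι → ℍ := unitVec ((1 - t) • u + t • v)

variable {u v : ι → ℍ} {t : ℝ}

theorem slerp_aux (hu : sqNorm u = 1) (hv : sqNorm v = 1) (h : v ≠ -u) {r s : ℝ} (hr : 0 ≤ r)
    (hs : 0 ≤ s) (hrs : r ≠ 0 ∨ s ≠ 0) : r • u + s • v ≠ 0 := fun h0 ↦ by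
  have h1 : r • u = s • (-v) := by rw [smul_neg]; exact eq_neg_of_add_eq_zero_left h0
  have h2 := eq_of_smul_eq_smul hu ((sqNorm_neg v).trans hv) hr hs hrs h1
  exact h (by rw [h2, neg_neg])

theorem slerp_segment_ne_zero (hu : sqNorm u = 1) (hv : sqNorm v = 1) (h : v ≠ -u) (ht : t ∈ I) :
    (1 - t) • u + t • v ≠ 0 := by
  refine slerp_aux hu hv h (sub_nonneg.2 ht.2) ht.1 ?_
  by_contra! h2
  linarith [h2.1, h2.2]

theorem sqNorm_slerp (hu : sqNorm u = 1) (hv : sqNorm v = 1) (h : v ≠ -u) (ht : t ∈ I) :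
    sqNorm (slerp u v t) = 1 := sqNorm_unitVec (slerp_segment_ne_zero hu hv h ht)

theorem smul_unitVec {w : ι → ℍ} (hw : w ≠ 0) : √(sqNorm w) • unitVec w = w := by
  rw [unitVec, smul_inv_smul₀ (Real.sqrt_pos.2 (sqNorm_pos hw)).ne']

theorem slerp_ne_neg_left (hu : sqNorm u = 1) (hv : sqNorm v = 1) (h : v ≠ -u) (ht : t ∈ I) :
    slerp u v t ≠ -u := fun h2 ↦ by
  have hw := slerp_segment_ne_zero hu hv h ht
  have h3 := smul_unitVec hw
  have h4 := Real.sqrt_pos.2 (sqNorm_pos hw)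
  rw [← slerp, h2] at h3
  set s := √(sqNorm ((1 - t) • u + t • v))
  refine slerp_aux hu hv h (r := 1 - t + s) (by linarith [ht.2]) ht.1
    (Or.inl (by linarith [ht.2])) ?_
  rw [add_smul, add_right_comm, ← h3, smul_neg, neg_add_cancel]

theorem slerp_ne_neg_right (hu : sqNorm u = 1) (hv : sqNorm v = 1) (h : v ≠ -u) (ht : t ∈ I) :
    slerp u v t ≠ -v := fun h2 ↦ by
  have hw := slerp_segment_ne_zero hu hv h ht
  have h3 := smul_unitVec hw
  have h4 := Real.sqrt_pos.2 (sqNorm_pos hw)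
  rw [← slerp, h2] at h3
  set s := √(sqNorm ((1 - t) • u + t • v))
  refine slerp_aux hu hv h (s := t + s) (sub_nonneg.2 ht.2) (by linarith [ht.1])
    (Or.inr (by linarith [ht.1])) ?_
  rw [add_smul, ← add_assoc, ← h3, smul_neg, neg_add_cancel]

theorem slerp_zero (hu : sqNorm u = 1) : slerp u v 0 = u := by
  simp [slerp, unitVec_of_sqNorm_eq_one hu]

theorem slerp_one (hv : sqNorm v = 1) : slerp u v 1 = v := by
  simp [slerp, unitVec_of_sqNorm_eq_one hv]

theorem slerp_self (hu : sqNorm u = 1) : slerp u u t = u := by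
  rw [slerp, ← add_smul, sub_add_cancel, one_smul, unitVec_of_sqNorm_eq_one hu]

theorem slerp_apply_eq_zero {i : ι} (hu : u i = 0) (hv : v i = 0) : slerp u v t i = 0 :=
  unitVec_apply_eq_zero (by simp [hu, hv])

theorem continuous_slerp {X : Type*} [TopologicalSpace X] {u v : X → ι → ℍ} {t : X → ℝ}
    (hu : Continuous u) (hv : Continuous v) (ht : Continuous t) (hu1 : ∀ x, sqNorm (u x) = 1)
    (hv1 : ∀ x, sqNorm (v x) = 1) (h : ∀ x, v x ≠ -u x) (ht1 : ∀ x, t x ∈ I) :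
    Continuous fun x ↦ slerp (u x) (v x) (t x) :=
  continuous_unitVec (by fun_prop) fun x ↦ slerp_segment_ne_zero (hu1 x) (hv1 x) (h x) (ht1 x)

end Slerp

section Compression

open Matrix

theorem norm_smul_add_self {V : Type*} [NormedAddCommGroup V] [NormedSpace ℝ V] {s : ℝ}
    (hs : 0 ≤ s) (v : V) : ‖s • v + v‖ = (s + 1) * ‖v‖ := by
  rw [← Real.norm_of_nonneg (show 0 ≤ s + 1 by linarith), ← norm_smul, add_smul, one_smul]

theorem ContinuousMap.HomotopicRel.mono {X Y : Type*} [TopologicalSpace X] [TopologicalSpace Y]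
    {f g : C(X, Y)} {S S' : Set X} (h : f.HomotopicRel g S) (hS : S' ⊆ S) :
    f.HomotopicRel g S' :=
  h.map fun H ↦ { H with prop' := fun t x hx ↦ H.prop' t x (hS hx) }

theorem ContinuousMap.homotopicRel_mul {X G : Type*} [TopologicalSpace X] [TopologicalSpace G]
    [Group G] [ContinuousMul G] (f : C(X, G)) (K : C(I × X, G)) {S : Set X}
    (h0 : ∀ x, K (0, x) = 1) (hS : ∀ t, ∀ x ∈ S, K (t, x) = 1) :
    f.HomotopicRel ⟨fun x ↦ K (1, x) * f x, by fun_prop⟩ S :=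
  ⟨{ toFun := fun z ↦ K z * f z.2
     continuous_toFun := by fun_prop
     map_zero_left := fun x ↦ by simp [h0]
     map_one_left := fun x ↦ rfl
     prop' := fun t x hx ↦ by simp [hS t x hx] }⟩

variable {ι : Type*} [Fintype ι] [DecidableEq ι]

theorem sqNorm_unitary_mulVec (A : unitary (Matrix ι ι ℍ)) (u : ι → ℍ) :
    sqNorm (A.1 *ᵥ u) = sqNorm u := by
  have h : star (A.1 *ᵥ u) ⬝ᵥ (A.1 *ᵥ u) = star u ⬝ᵥ u := by
    rw [star_mulVec, ← dotProduct_mulVec, mulVec_mulVec, ← star_eq_conjTranspose,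
      (Unitary.mem_iff.1 A.2).1, one_mulVec]
  rw [star_dotProduct_self, star_dotProduct_self] at h
  exact congrArg QuaternionAlgebra.re h

theorem unitary_inv_mulVec {A : unitary (Matrix ι ι ℍ)} {u v : ι → ℍ} (h : A.1 *ᵥ u = v) :
    (A⁻¹).1 *ᵥ v = u := by
  rw [← h, mulVec_mulVec, ← Submonoid.coe_mul, inv_mul_cancel, OneMemClass.coe_one, one_mulVec]

/-- A unitary matrix fixing a basis vector has zero entries in the corresponding row, off the
diagonal. -/
theorem unitary_mulVec_single_apply_eq_zero {A : unitary (Matrix ι ι ℍ)} {j m : ι} (hjm : m ≠ j)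
    (h : A.1 *ᵥ Pi.single j 1 = Pi.single j 1) : (A.1 *ᵥ Pi.single m 1) j = 0 := by
  have h1 := congrFun (unitary_inv_mulVec h) m
  rw [Pi.single_eq_of_ne hjm, ← Unitary.star_eq_inv] at h1
  simpa [star_apply] using h1

variable {E : Type*} [NormedAddCommGroup E] [NormedSpace ℝ E] [FiniteDimensional ℝ E]

/-- Sphere-valued maps from low-dimensional spaces are close to maps missing a point. -/
theorem exists_approx_missing (T : Finset ι) {m : ι} (hm : m ∉ T)
    (hE : Module.finrank ℝ E + 1 < 4 * Fintype.card {j // j ∉ T}) {h : E → ι → ℍ}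
    (hc : Continuous h) (h1 : ∀ x, sqNorm (h x) = 1) (hT : ∀ x, ∀ j ∈ T, h x j = 0) :
    ∃ (g : E → ι → ℍ) (q : ι → ℍ), Continuous g ∧ (∀ x, sqNorm (g x) = 1) ∧
      (∀ x, ∀ j ∈ T, g x j = 0) ∧ (∀ x, g x ≠ -h x) ∧
      (∀ x, h x = Pi.single m 1 → g x = Pi.single m 1) ∧
      sqNorm q = 1 ∧ (∀ j ∈ T, q j = 0) ∧ (∀ x, g x ≠ q) ∧ Pi.single m 1 ≠ q := by
  classical
  let r : (ι → ℍ) →ₗ[ℝ] ({j // j ∉ T} → ℍ) := LinearMap.funLeft ℝ ℍ Subtype.val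
  let ex : ({j // j ∉ T} → ℍ) →ₗ[ℝ] (ι → ℍ) :=
    { toFun := fun v j ↦ if hj : j ∈ T then 0 else v ⟨j, hj⟩
      map_add' := fun v w ↦ by ext1 j; by_cases hj : j ∈ T <;> simp [hj]
      map_smul' := fun c v ↦ by ext1 j; by_cases hj : j ∈ T <;> simp [hj] }
  have rex (v : {j // j ∉ T} → ℍ) : r (ex v) = v := by
    ext1 ⟨j, hj⟩; simp [r, ex, LinearMap.funLeft, hj]
  have exr (u : ι → ℍ) (hu : ∀ j ∈ T, u j = 0) : ex (r u) = u := by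
    ext1 j
    by_cases hj : j ∈ T
    · simp [ex, hj, hu j hj]
    · simp [r, ex, hj, LinearMap.funLeft]
  have exT (v : {j // j ∉ T} → ℍ) (j) (hj : j ∈ T) : ex v j = 0 := by simp [ex, hj]
  have exc : Continuous ex := continuous_pi fun j ↦ by
    by_cases hj : j ∈ T
    · simpa [ex, hj] using continuous_const
    · simpa [ex, hj] using continuous_apply _
  have rc : Continuous r := continuous_pi fun j ↦ continuous_apply _
  set e : ι → ℍ := Pi.single m 1 with he
  have e1 : sqNorm e = 1 := sqNorm_single m
  have eT : ∀ j ∈ T, e j = 0 := fun j hj ↦ Pi.single_eq_of_ne (by rintro rfl; exact hm hj) _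
  have hr0 (u : ι → ℍ) (hu : ∀ j ∈ T, u j = 0) (hu1 : sqNorm u = 1) : 0 < ‖r u‖ := by
    refine norm_pos_iff.2 fun h0 ↦ ne_zero_of_sqNorm_eq_one hu1 ?_
    rw [← exr u hu, h0, map_zero]
  obtain ⟨g₀, g₀s, g₀d, g₀e⟩ := (show Continuous fun x ↦ r (h x) - r e by
    fun_prop).exists_contDiff_approx 1 (ε := fun x ↦ ‖r (h x)‖) (by fun_prop)
      fun x ↦ hr0 _ (hT x) (h1 x)
  let g : E → {j // j ∉ T} → ℍ := fun x ↦ g₀ x + r e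
  have gs : ContDiff ℝ 1 g := g₀s.add contDiff_const
  have gd (x) : ‖g x - r (h x)‖ < ‖r (h x)‖ := by
    have := g₀d x
    rwa [dist_eq_norm, sub_sub_eq_add_sub] at this
  have ge (x) (hx : h x = e) : g x = r e := by
    have : g₀ x = 0 := by
      by_contra h0
      exact g₀e h0 (by simp [hx])
    simp [g, this]
  have gh (x) (s : ℝ) (hs : 0 ≤ s) : g x ≠ -(s • r (h x)) := fun h0 ↦ by
    have := gd x
    rw [h0, ← neg_add', norm_neg, norm_smul_add_self hs] at this
    nlinarith [hr0 _ (hT x) (h1 x)]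
  have exg0 (x) : ex (g x) ≠ 0 := fun h0 ↦ by
    refine gh x 0 le_rfl ?_
    rw [← rex (g x), h0, map_zero, zero_smul, neg_zero]
  have hdim : Module.finrank ℝ (ℝ × E) < Module.finrank ℝ ({j // j ∉ T} → ℍ) := by
    rw [Module.finrank_prod, Module.finrank_self, Module.finrank_pi_fintype]
    simp only [Quaternion.finrank_eq_four, Finset.sum_const, Finset.card_univ, smul_eq_mul]
    omega
  obtain ⟨q, hq, hqd⟩ := (ContDiff.dense_compl_range_of_finrank_lt_finrank
    (f := fun z : ℝ × E ↦ z.1 • g z.2) (contDiff_fst.smul (gs.comp contDiff_snd))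
      hdim).exists_dist_lt (-r e) (hr0 _ eT e1)
  have hq' (a : ℝ) (x : E) : q ≠ a • g x := fun h0 ↦ hq ⟨(a, x), h0.symm⟩
  have exq0 : ex q ≠ 0 := fun h0 ↦ by
    refine hq' 0 0 ?_
    rw [← rex q, h0, map_zero, zero_smul]
  have hqe (s : ℝ) (hs : 0 ≤ s) : q ≠ s • r e := fun h0 ↦ by
    rw [h0, dist_eq_norm, ← neg_add', norm_neg, add_comm, norm_smul_add_self hs] at hqd
    nlinarith [hr0 _ eT e1]
  refine ⟨fun x ↦ unitVec (ex (g x)), unitVec (ex q),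
    continuous_unitVec (exc.comp gs.continuous) exg0, fun x ↦ sqNorm_unitVec (exg0 x),
    fun x j hj ↦ unitVec_apply_eq_zero (exT _ j hj), fun x hx ↦ ?_, fun x hx ↦ ?_,
    sqNorm_unitVec exq0, fun j hj ↦ unitVec_apply_eq_zero (exT _ j hj), fun x hx ↦ ?_,
    fun hx ↦ ?_⟩
  · refine gh x (√(sqNorm (ex (g x)))) (Real.sqrt_nonneg _) ?_
    have := congrArg r (smul_unitVec (exg0 x))
    rw [show unitVec (ex (g x)) = -h x from hx, rex, smul_neg, map_neg, map_smul] at this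
    exact this.symm
  · simp only
    rw [ge x hx, exr e eT, unitVec_of_sqNorm_eq_one e1]
  · refine hq' (√(sqNorm (ex q)) * (√(sqNorm (ex (g x))))⁻¹) x ?_
    have := congrArg r (smul_unitVec exq0)
    rw [← show unitVec (ex (g x)) = unitVec (ex q) from hx, rex, map_smul, unitVec, map_smul,
      rex, smul_smul] at this
    exact this.symm
  · refine hqe (√(sqNorm (ex q))) (Real.sqrt_nonneg _) ?_
    have := congrArg r (smul_unitVec exq0)
    rw [← hx, rex, map_smul] at this
    exact this.symm

/-- A family of unitary matrices fixing the basis vectors in `T`, over a space of low dimension,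
can be deformed to fix one more basis vector. -/
theorem exists_homotopicRel_fix_insert (T : Finset ι) {m : ι} (hm : m ∉ T)
    (hE : Module.finrank ℝ E + 1 < 4 * Fintype.card {j // j ∉ T})
    (f : C(E, unitary (Matrix ι ι ℍ)))
    (hf : ∀ x, ∀ j ∈ T, (f x).1 *ᵥ Pi.single j 1 = Pi.single j 1) :
    ∃ f' : C(E, unitary (Matrix ι ι ℍ)),
      f.HomotopicRel f' {x | (f x).1 *ᵥ Pi.single m 1 = Pi.single m 1} ∧
      ∀ x, ∀ j ∈ insert m T, (f' x).1 *ᵥ Pi.single j 1 = Pi.single j 1 := by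
  set e : ι → ℍ := Pi.single m 1 with he
  have e1 : sqNorm e = 1 := sqNorm_single m
  have eT : ∀ j ∈ T, e j = 0 := fun j hj ↦ Pi.single_eq_of_ne (by rintro rfl; exact hm hj) _
  let h : E → ι → ℍ := fun x ↦ (f x).1 *ᵥ e
  have hc : Continuous h := (continuous_subtype_val.comp f.continuous).matrix_mulVec
    continuous_const
  have h1 (x) : sqNorm (h x) = 1 := (sqNorm_unitary_mulVec _ _).trans e1
  have hT (x) (j) (hj : j ∈ T) : h x j = 0 :=
    unitary_mulVec_single_apply_eq_zero (by rintro rfl; exact hm hj) (hf x j hj)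
  obtain ⟨g, q, gc, g1, gT, gh, ge, q1, qT, gq, eq⟩ := exists_approx_missing T hm hE hc h1 hT
  replace ge (x) (hx : h x = e) : g x = e := ge x hx
  have q1' : sqNorm (-q) = 1 := (sqNorm_neg q).trans q1
  have qT' (j) (hj : j ∈ T) : (-q) j = 0 := by simp [qT j hj]
  have gq' (x) : -q ≠ -g x := fun h0 ↦ gq x (neg_injective h0).symm
  have eq' : -q ≠ -e := fun h0 ↦ eq (neg_injective h0).symm
  let K₁ : C(I × E, unitary (Matrix ι ι ℍ)) :=
    ⟨fun z ↦ quatRotation (h z.2) (slerp (h z.2) (g z.2) z.1),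
      continuous_quatRotation (by fun_prop) (continuous_slerp (by fun_prop) (by fun_prop)
        (by fun_prop) (fun _ ↦ h1 _) (fun _ ↦ g1 _) (fun _ ↦ gh _) (fun z ↦ z.1.2))
        (fun _ ↦ h1 _) (fun z ↦ sqNorm_slerp (h1 _) (g1 _) (gh _) z.1.2)
        (fun z ↦ slerp_ne_neg_left (h1 _) (g1 _) (gh _) z.1.2)⟩
  have hN (v : I × E → ι → ℍ) (hv : Continuous v) (v1 : ∀ z, sqNorm (v z) = 1)
      (vq : ∀ z, -q ≠ -v z) : Continuous fun z ↦ quatRotation (-q) (slerp (v z) (-q) z.1) :=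
    continuous_quatRotation continuous_const (continuous_slerp (by fun_prop) (by fun_prop)
        (by fun_prop) (fun _ ↦ v1 _) (fun _ ↦ q1') vq (fun z ↦ z.1.2))
        (fun _ ↦ q1') (fun z ↦ sqNorm_slerp (v1 _) q1' (vq _) z.1.2)
        (fun z ↦ slerp_ne_neg_right (v1 _) q1' (vq _) z.1.2)
  have ha := hN (fun z ↦ g z.2) (by fun_prop) (fun _ ↦ g1 _) (fun _ ↦ gq' _)
  have hb := hN (fun _ ↦ e) (by fun_prop) (fun _ ↦ e1) (fun _ ↦ eq')
  let N (t : I) (x : E) : unitary (Matrix ι ι ℍ) := quatRotation (-q) (slerp (g x) (-q) t) *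
    (quatRotation (-q) (slerp e (-q) t))⁻¹
  have hNc : Continuous fun z : I × E ↦ N z.1 z.2 := ha.mul hb.inv
  let K₂ : C(I × E, unitary (Matrix ι ι ℍ)) :=
    ⟨fun z ↦ N z.1 z.2 * (N 0 z.2)⁻¹, by
      exact hNc.mul ((hNc.comp (continuous_const.prodMk continuous_snd)).inv)⟩
  have hfix₁ (z : I × E) : ∀ j ∈ T, (K₁ z).1 *ᵥ Pi.single j 1 = Pi.single j 1 := fun j hj ↦
    quatRotation_mulVec_single (hT _ j hj) (slerp_apply_eq_zero (hT _ j hj) (gT _ j hj))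
  have hfixN (t x) : ∀ j ∈ T, (N t x).1 *ᵥ Pi.single j 1 = Pi.single j 1 := fun j hj ↦ by
    rw [Submonoid.coe_mul, ← mulVec_mulVec, unitary_inv_mulVec (quatRotation_mulVec_single
      (qT' j hj) (slerp_apply_eq_zero (eT j hj) (qT' j hj))), quatRotation_mulVec_single
      (qT' j hj) (slerp_apply_eq_zero (gT x j hj) (qT' j hj))]
  have hfix₂ (z : I × E) : ∀ j ∈ T, (K₂ z).1 *ᵥ Pi.single j 1 = Pi.single j 1 := fun j hj ↦ by
    rw [ContinuousMap.coe_mk, Submonoid.coe_mul, ← mulVec_mulVec,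
      unitary_inv_mulVec (hfixN 0 z.2 j hj), hfixN z.1 z.2 j hj]
  have hN1 (x) : N 1 x = 1 := by
    simp only [N, Set.Icc.coe_one, slerp_one q1', quatRotation_self q1', inv_one, mul_one]
  have hN0 (x) : (N 0 x).1 *ᵥ e = g x := by
    have h0 : (quatRotation (-q) e).1 *ᵥ (-q) = e :=
      quatRotation_mulVec q1' e1 (by rw [neg_neg]; exact eq)
    simp only [N, Set.Icc.coe_zero, slerp_zero e1, slerp_zero (g1 x)]
    rw [Submonoid.coe_mul, ← mulVec_mulVec, unitary_inv_mulVec h0,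
      quatRotation_mulVec q1' (g1 x) (by rw [neg_neg]; exact gq x)]
  have hr₁ := f.homotopicRel_mul K₁ (S := {x | h x = e})
    (fun x ↦ by
      simp only [K₁, ContinuousMap.coe_mk, Set.Icc.coe_zero, slerp_zero (h1 x),
        quatRotation_self (h1 x)])
    (fun t x hx ↦ by
      have hx' : h x = e := hx
      simp only [K₁, ContinuousMap.coe_mk, hx', ge x hx', slerp_self e1, quatRotation_self e1])
  set f₁ : C(E, unitary (Matrix ι ι ℍ)) := ⟨fun x ↦ K₁ (1, x) * f x, by fun_prop⟩ with hf₁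
  have hr₂ := f₁.homotopicRel_mul K₂ (S := {x | h x = e})
    (fun x ↦ by simp only [K₂, ContinuousMap.coe_mk, mul_inv_cancel])
    (fun t x hx ↦ by
      have hx' : h x = e := hx
      simp only [K₂, N, ContinuousMap.coe_mk, ge x hx', mul_inv_cancel, inv_one, mul_one])
  refine ⟨_, hr₁.trans hr₂, fun x j hj ↦ ?_⟩
  have hmul (v : ι → ℍ) : (K₂ (1, x) * (K₁ (1, x) * f x)).1 *ᵥ v =
      (K₂ (1, x)).1 *ᵥ ((K₁ (1, x)).1 *ᵥ ((f x).1 *ᵥ v)) := by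
    rw [Submonoid.coe_mul, Submonoid.coe_mul, ← mulVec_mulVec, ← mulVec_mulVec]
  refine (hmul _).trans ?_
  rcases Finset.mem_insert.1 hj with rfl | hj
  · have hk : (K₁ (1, x)).1 *ᵥ h x = g x := by
      simp only [K₁, ContinuousMap.coe_mk, Set.Icc.coe_one, slerp_one (g1 x)]
      exact quatRotation_mulVec (h1 x) (g1 x) (gh x)
    have hk2 : (K₂ (1, x)).1 *ᵥ g x = e := by
      simp only [K₂, ContinuousMap.coe_mk, hN1, one_mul]
      exact unitary_inv_mulVec (hN0 x)
    exact (congrArg _ hk).trans hk2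
  · rw [hf x j hj, hfix₁ _ j hj, hfix₂ _ j hj]

theorem exists_homotopicRel_fix (T : Finset ι)
    (hE : Module.finrank ℝ E + 1 < 4 * (Fintype.card ι - T.card + 1))
    (f : C(E, unitary (Matrix ι ι ℍ))) :
    ∃ f' : C(E, unitary (Matrix ι ι ℍ)),
      f.HomotopicRel f' {x | ∀ j ∈ T, (f x).1 *ᵥ Pi.single j 1 = Pi.single j 1} ∧
      ∀ x, ∀ j ∈ T, (f' x).1 *ᵥ Pi.single j 1 = Pi.single j 1 := by
  induction T using Finset.induction_on with
  | empty => exact ⟨f, .refl _, by simp⟩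
  | insert m T hm ih =>
    have hcard := Finset.card_insert_of_notMem hm
    have hle := Finset.card_le_univ (insert m T)
    obtain ⟨f₁, h₁, h₁'⟩ := ih (by omega)
    obtain ⟨f₂, h₂, h₂'⟩ := exists_homotopicRel_fix_insert T hm (by
      rw [Fintype.card_subtype_compl, Fintype.card_coe]; omega) f₁ h₁'
    refine ⟨f₂, .trans (.mono h₁ ?_) (.mono h₂ ?_), h₂'⟩
    · exact fun x hx j hj ↦ hx j (Finset.mem_insert_of_mem hj)
    · intro x hx
      obtain ⟨H⟩ := h₁
      have : f x = f₁ x := H.fst_eq_snd fun j hj ↦ hx j (Finset.mem_insert_of_mem hj)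
      simpa only [Set.mem_ofPred_eq, ← this] using hx m (Finset.mem_insert_self m T)

end Compression

section ClampedHomotopy

variable {N G : Type*} [TopologicalSpace G] [Group G]

theorem CubeSupported.apply_cubeClamp {F : (N → ℝ) → G} (hF : CubeSupported F) (x : N → ℝ) :
    F (fun i ↦ cubeClamp x i) = F x := by
  by_cases hx : ∃ i, x i ≤ 0 ∨ 1 ≤ x i
  · obtain ⟨i, hi⟩ := cubeClamp_mem_boundary hx
    rw [hF.2 x hx, hF.2 _ ⟨i, hi.imp (fun h ↦ ?_) fun h ↦ ?_⟩] <;> simp [h]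
  · push Not at hx
    congr 1
    ext i
    exact congrArg Subtype.val (Set.projIcc_of_mem zero_le_one ⟨(hx i).1.le, (hx i).2.le⟩)

variable [DecidableEq N] [Nonempty N]

theorem exists_homotopy_of_cubeClass_eq {F F' : (N → ℝ) → G} (hF : CubeSupported F)
    (hF' : CubeSupported F') (h : cubeClass F = cubeClass F') :
    ∃ K : ℝ → (N → ℝ) → G, (Continuous fun z : ℝ × (N → ℝ) ↦ K z.1 z.2) ∧
      (∀ t ≤ 0, K t = F) ∧ (∀ t ≥ 1, K t = F') ∧
      ∀ t x, (∃ i, x i ≤ 0 ∨ 1 ≤ x i) → K t x = 1 := by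
  rw [cubeClass_eq hF, cubeClass_eq hF'] at h
  obtain ⟨H⟩ := Quotient.exact h
  refine ⟨fun t x ↦ H (Set.projIcc 0 1 zero_le_one t, cubeClamp x), ?_, fun t ht ↦ ?_,
    fun t ht ↦ ?_, fun t x hx ↦ ?_⟩
  · exact H.continuous.comp ((continuous_projIcc.comp continuous_fst).prodMk
      (continuous_cubeClamp.comp continuous_snd))
  · ext1 x
    simp only [Set.projIcc_of_le_left _ ht]
    exact (H.apply_zero _).trans (hF.apply_cubeClamp x)
  · ext1 x
    simp only [Set.projIcc_of_right_le _ ht]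
    exact (H.apply_one _).trans (hF'.apply_cubeClamp x)
  · simp only [H.eq_fst _ (cubeClamp_mem_boundary hx)]
    exact hF.toGenLoop.2 _ (cubeClamp_mem_boundary hx)

theorem map_cubeClass {H : Type*} [TopologicalSpace H] [Group H] (f : C(G, H)) (hf : f 1 = 1)
    {F : (N → ℝ) → G} (hF : CubeSupported F) :
    HomotopyGroup.map f hf (cubeClass F) = cubeClass fun x ↦ f (F x) := by
  have h : CubeSupported fun x ↦ f (F x) :=
    ⟨f.continuous.comp hF.1, fun x hx ↦ (congrArg f (hF.2 x hx)).trans hf⟩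
  rw [cubeClass_eq hF, cubeClass_eq h, HomotopyGroup.map_mk]
  rfl

end ClampedHomotopy

section Stabilization

open Matrix

variable {ι : Type*} [Fintype ι] [DecidableEq ι] (i₀ : ι)

/-- The inclusion of the unit quaternions in `Sp(n)` as one diagonal entry. -/
noncomputable def diagUnit : C(unitary ℍ, unitary (Matrix ι ι ℍ)) where
  toFun q := ⟨diagonal (Pi.mulSingle i₀ (q : ℍ)), by
    rw [Unitary.mem_iff, star_eq_conjTranspose, diagonal_conjTranspose, diagonal_mul_diagonal,
      diagonal_mul_diagonal, ← diagonal_one]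
    constructor <;> congr 1 <;> ext1 i <;> by_cases hi : i = i₀
    · subst hi; simp
    · simp [hi]
    · subst hi; simp
    · simp [hi]⟩
  continuous_toFun := by
    refine continuous_induced_rng.2 (Continuous.matrix_diagonal ?_)
    exact (continuous_mulSingle i₀).comp continuous_subtype_val

theorem diagUnit_one : diagUnit i₀ 1 = 1 := Subtype.ext (by simp [diagUnit])

theorem diagUnit_injective : Function.Injective (diagUnit i₀) := fun q q' h ↦ by
  have := congrFun (congrFun (congrArg Subtype.val h) i₀) i₀
  exact Subtype.ext (by simpa [diagUnit] using this)

theorem diagUnit_mulVec_single (q : unitary ℍ) {j : ι} (hj : j ≠ i₀) :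
    (diagUnit i₀ q).1 *ᵥ Pi.single j 1 = Pi.single j 1 := by
  change diagonal _ *ᵥ _ = _
  ext1 i
  rw [mulVec_diagonal]
  by_cases hi : i = j
  · subst hi; simp [hj]
  · simp [hi]

/-- Unitary matrices fixing all basis vectors but one come from unit quaternions. -/
theorem exists_diagUnit_eq {A : unitary (Matrix ι ι ℍ)}
    (hA : ∀ j, j ≠ i₀ → A.1 *ᵥ Pi.single j 1 = Pi.single j 1) : ∃ q, diagUnit i₀ q = A := by
  have hd : A.1 = diagonal (Pi.mulSingle i₀ (A.1 i₀ i₀)) := by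
    ext1 i j
    by_cases hj : j = i₀
    · subst hj
      by_cases hi : i = j
      · subst hi; simp
      · have := unitary_mulVec_single_apply_eq_zero (Ne.symm hi) (hA i hi)
        rw [diagonal_apply_ne _ hi]
        simpa using this
    · have := congrFun (hA j hj) i
      rw [mulVec_single_one, col_apply] at this
      rw [this, diagonal_apply, Pi.single_apply]
      split_ifs with h
      · subst h; simp [hj]
      · rfl
  have h1 := Unitary.mem_iff.1 A.2
  rw [hd, star_eq_conjTranspose, diagonal_conjTranspose, diagonal_mul_diagonal,
    diagonal_mul_diagonal] at h1
  refine ⟨⟨A.1 i₀ i₀, Unitary.mem_iff.2 ⟨?_, ?_⟩⟩, Subtype.ext hd.symm⟩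
  · simpa using congrFun (congrFun h1.1 i₀) i₀
  · simpa using congrFun (congrFun h1.2 i₀) i₀

theorem continuous_of_diagUnit_comp {X : Type*} [TopologicalSpace X] {F : X → unitary ℍ}
    (h : Continuous fun x ↦ diagUnit i₀ (F x)) : Continuous F := by
  refine continuous_induced_rng.2 ?_
  have h2 : Continuous fun x ↦ (diagUnit i₀ (F x)).1 i₀ i₀ :=
    (continuous_subtype_val.comp h).matrix_elem i₀ i₀
  simpa [diagUnit, Function.comp_def] using h2

/-- Low-dimensional families of unitary matrices can be deformed to families of unit quaternions,
keeping the members that already are. -/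
theorem exists_homotopicRel_diagUnit {E : Type*} [NormedAddCommGroup E] [NormedSpace ℝ E]
    [FiniteDimensional ℝ E] (hE : Module.finrank ℝ E ≤ 6) (f : C(E, unitary (Matrix ι ι ℍ))) :
    ∃ F : E → unitary ℍ, Continuous F ∧ ∃ f' : C(E, unitary (Matrix ι ι ℍ)),
      (∀ x, f' x = diagUnit i₀ (F x)) ∧ f.HomotopicRel f' {x | f x ∈ Set.range (diagUnit i₀)} := by
  have hpos : 0 < Fintype.card ι := Fintype.card_pos_iff.2 ⟨i₀⟩
  obtain ⟨f', h, h'⟩ := exists_homotopicRel_fix (Finset.univ.erase i₀) (by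
    rw [Finset.card_erase_of_mem (Finset.mem_univ _), Finset.card_univ]; omega) f
  choose F hF using fun x ↦ exists_diagUnit_eq i₀ fun j hj ↦
    h' x j (Finset.mem_erase.2 ⟨hj, Finset.mem_univ j⟩)
  refine ⟨F, continuous_of_diagUnit_comp i₀ ?_, f', fun x ↦ (hF x).symm, h.mono ?_⟩
  · simp only [hF]
    exact f'.continuous
  · rintro x ⟨q, hq⟩ j hj
    rw [← hq]
    exact diagUnit_mulVec_single i₀ q (Finset.ne_of_mem_erase hj)

theorem diagUnit_map_bijective : Function.Bijective
    (HomotopyGroup.map (N := Fin 3) (diagUnit i₀) (diagUnit_one i₀)) := by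
  have hone : (1 : unitary (Matrix ι ι ℍ)) ∈ Set.range (diagUnit i₀) := ⟨1, diagUnit_one i₀⟩
  constructor
  · rw [injective_iff_map_eq_one]
    intro c hc
    obtain ⟨F, hF, rfl⟩ := exists_cubeClass_eq c
    rw [map_cubeClass _ _ hF, ← cubeClass_one] at hc
    obtain ⟨K, Kc, K0, K1, Kb⟩ := exists_homotopy_of_cubeClass_eq
      ⟨(diagUnit i₀).continuous.comp hF.1, fun x hx ↦
        (congrArg _ (hF.2 x hx)).trans (diagUnit_one i₀)⟩ .one hc
    obtain ⟨L, Lc, f', hL, hK⟩ := exists_homotopicRel_diagUnit i₀ (E := ℝ × (Fin 3 → ℝ))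
      (by simp) ⟨fun z ↦ K z.1 z.2, Kc⟩
    have hKL (t x) (h : K t x ∈ Set.range (diagUnit i₀)) : diagUnit i₀ (L (t, x)) = K t x := by
      rw [← hL]
      exact (hK.fst_eq_snd (x := (t, x)) h).symm
    have hL0 : (fun x ↦ L (0, x)) = F := funext fun x ↦ diagUnit_injective i₀ (by
      rw [hKL _ _ (K0 0 le_rfl ▸ ⟨F x, rfl⟩), K0 0 le_rfl]; rfl)
    have hL1 : (fun x ↦ L (1, x)) = 1 := funext fun x ↦ diagUnit_injective i₀ (by
      rw [hKL _ _ (K1 1 le_rfl ▸ hone), K1 1 le_rfl, Pi.one_apply, Pi.one_apply, diagUnit_one])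
    have := cubeClass_eq_of_homotopy (fun t x ↦ L (t, x)) (by fun_prop) fun t x hx ↦
      diagUnit_injective i₀ (by
        rw [hKL _ _ (Kb _ x hx ▸ hone), Kb _ x hx, diagUnit_one])
    simpa only [Set.Icc.coe_zero, Set.Icc.coe_one, hL0, hL1, cubeClass_one] using this
  · intro c
    obtain ⟨F, hF, rfl⟩ := exists_cubeClass_eq c
    obtain ⟨L, Lc, f', hL, ⟨H⟩⟩ := exists_homotopicRel_diagUnit i₀ (by simp) ⟨F, hF.1⟩
    have hS (x) (hx : ∃ i, x i ≤ 0 ∨ 1 ≤ x i) :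
        x ∈ {x | (⟨F, hF.1⟩ : C(Fin 3 → ℝ, unitary (Matrix ι ι ℍ))) x ∈
          Set.range (diagUnit i₀)} := by
      refine ⟨1, (diagUnit_one i₀).trans ?_⟩
      exact (hF.2 x hx).symm
    have hLs : CubeSupported L := ⟨Lc, fun x hx ↦ diagUnit_injective i₀ (by
      rw [← hL, ← H.fst_eq_snd (hS x hx), diagUnit_one]
      exact hF.2 x hx)⟩
    refine ⟨cubeClass L, ?_⟩
    rw [map_cubeClass _ _ hLs]
    have := cubeClass_eq_of_homotopy (fun t x ↦ H (t, x)) H.continuous fun t x hx ↦ by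
      rw [H.eq_fst t (hS x hx)]
      exact hF.2 x hx
    simp only [H.apply_zero, H.apply_one, hL] at this
    exact this.symm

end Stabilization

section UnitQuat

theorem norm_unitary_quaternion (u : unitary ℍ) : ‖(u : ℍ)‖ = 1 := by
  have h := (Unitary.mem_iff.1 u.2).1
  rw [Quaternion.star_mul_self, Quaternion.normSq_eq_norm_mul_self, ← Quaternion.coe_one,
    Quaternion.coe_inj] at h
  nlinarith [norm_nonneg (u : ℍ)]

theorem unitary_quaternion_ne_zero (u : unitary ℍ) : (u : ℍ) ≠ 0 :=
  norm_ne_zero_iff.1 (by rw [norm_unitary_quaternion]; exact one_ne_zero)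

open Classical in
/-- The unit quaternion in the direction of a nonzero quaternion. -/
noncomputable def unitQuat (w : ℍ) : unitary ℍ :=
  if hw : w ≠ 0 then ⟨‖w‖⁻¹ • w, by
    have : (‖w‖⁻¹ * ‖w‖⁻¹) * (‖w‖ * ‖w‖) = 1 := by
      have := norm_ne_zero_iff.2 hw
      field_simp
    rw [Unitary.mem_iff, Quaternion.star_smul, smul_mul_smul_comm, smul_mul_smul_comm,
      Quaternion.star_mul_self, Quaternion.self_mul_star, Quaternion.normSq_eq_norm_mul_self,
      Quaternion.smul_coe, this, Quaternion.coe_one]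
    exact ⟨rfl, rfl⟩⟩ else 1

theorem coe_unitQuat {w : ℍ} (hw : w ≠ 0) : (unitQuat w : ℍ) = ‖w‖⁻¹ • w := by
  rw [unitQuat, dif_pos hw]

theorem unitQuat_coe_of_pos {r : ℝ} (hr : 0 < r) : unitQuat (r : ℍ) = 1 := by
  have h : (r : ℍ) ≠ 0 := by rw [← Quaternion.coe_zero, Ne, Quaternion.coe_inj]; exact hr.ne'
  refine Subtype.ext ?_
  rw [coe_unitQuat h, Quaternion.norm_coe, Real.norm_of_nonneg hr.le, Quaternion.smul_coe,
    inv_mul_cancel₀ hr.ne', Quaternion.coe_one, OneMemClass.coe_one]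

theorem unitQuat_coe (u : unitary ℍ) : unitQuat (u : ℍ) = u := by
  refine Subtype.ext ?_
  rw [coe_unitQuat (unitary_quaternion_ne_zero u), norm_unitary_quaternion, inv_one, one_smul]

theorem continuous_unitQuat {X : Type*} [TopologicalSpace X] {W : X → ℍ} (hW : Continuous W)
    (h0 : ∀ x, W x ≠ 0) : Continuous fun x ↦ unitQuat (W x) := by
  refine continuous_induced_rng.2 ?_
  have : (Subtype.val ∘ fun x ↦ unitQuat (W x)) = fun x ↦ ‖W x‖⁻¹ • W x :=
    funext fun x ↦ coe_unitQuat (h0 x)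
  rw [this]
  exact (hW.norm.inv₀ fun x ↦ norm_ne_zero_iff.2 (h0 x)).smul hW

end UnitQuat

section Bump

/-- The quaternion with given real and imaginary parts. -/
def quat (a : ℝ) (v : Fin 3 → ℝ) : ℍ := ⟨a, v 0, v 1, v 2⟩

/-- The imaginary part of a quaternion, as a vector. -/
def imVec (q : ℍ) : Fin 3 → ℝ := ![q.imI, q.imJ, q.imK]

/-- The squared Euclidean norm on `ℝ³`. -/
def nsq (v : Fin 3 → ℝ) : ℝ := v 0 ^ 2 + v 1 ^ 2 + v 2 ^ 2

theorem continuous_imVec : Continuous imVec := by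
  refine continuous_pi fun i ↦ ?_
  fin_cases i
  · exact Quaternion.continuous_imI
  · exact Quaternion.continuous_imJ
  · exact Quaternion.continuous_imK

theorem continuous_quat : Continuous fun z : ℝ × (Fin 3 → ℝ) ↦ quat z.1 z.2 := by
  have h : (fun z : ℝ × (Fin 3 → ℝ) ↦ quat z.1 z.2) = fun z ↦
      Quaternion.linearIsometryEquivTuple.symm (WithLp.toLp 2 ![z.1, z.2 0, z.2 1, z.2 2]) := by
    ext z <;> simp [quat]
  rw [h]
  refine (LinearIsometryEquiv.continuous _).comp ((PiLp.continuous_toLp 2 _).comp ?_)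
  refine continuous_pi fun i ↦ ?_
  fin_cases i <;> simp <;> fun_prop

theorem continuous_nsq : Continuous nsq := by unfold nsq; fun_prop

theorem norm_sq_le_nsq (v : Fin 3 → ℝ) : ‖v‖ ^ 2 ≤ nsq v := by
  have h (i) : ‖v i‖ ^ 2 ≤ nsq v := by
    rw [Real.norm_eq_abs, sq_abs, nsq]
    fin_cases i <;> simp <;> nlinarith [sq_nonneg (v 0), sq_nonneg (v 1), sq_nonneg (v 2)]
  have h2 : ‖v‖ ≤ √(nsq v) :=
    (pi_norm_le_iff_of_nonneg (Real.sqrt_nonneg _)).2 fun i ↦ Real.le_sqrt_of_sq_le (h i)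
  have h3 : 0 ≤ nsq v := (sq_nonneg _).trans (h 0)
  nlinarith [Real.sq_sqrt h3, norm_nonneg v, Real.sqrt_nonneg (nsq v)]

theorem one_le_nsq {v : Fin 3 → ℝ} (hv : 1 ≤ ‖v‖) : 1 ≤ nsq v := by
  nlinarith [norm_sq_le_nsq v]

theorem nsq_eq_zero {v : Fin 3 → ℝ} : nsq v = 0 ↔ v = 0 := by
  refine ⟨fun h ↦ norm_eq_zero.1 ?_, fun h ↦ by simp [h, nsq]⟩
  nlinarith [norm_sq_le_nsq v, norm_nonneg v]

theorem nsq_nonneg (v : Fin 3 → ℝ) : 0 ≤ nsq v := by unfold nsq; positivity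

/-- A smooth function positive exactly on the open unit ball. -/
noncomputable def ballBump (v : Fin 3 → ℝ) : ℝ := expNegInvGlue (1 - nsq v)

/-- An unnormalised degree one map from the unit ball to the sphere of quaternions,
constant on the boundary. -/
noncomputable def bumpNum (v : Fin 3 → ℝ) : ℍ :=
  quat (nsq v - ballBump v ^ 2) ((2 * ballBump v) • v)

theorem ballBump_nonneg (v : Fin 3 → ℝ) : 0 ≤ ballBump v := expNegInvGlue.nonneg _

theorem ballBump_eq_zero {v : Fin 3 → ℝ} (hv : 1 ≤ nsq v) : ballBump v = 0 :=
  expNegInvGlue.zero_of_nonpos (by linarith)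

theorem ballBump_zero_pos : 0 < ballBump 0 := expNegInvGlue.pos_of_pos (by simp [nsq])

theorem nsq_add_ballBump_pos (v : Fin 3 → ℝ) : 0 < nsq v + ballBump v ^ 2 := by
  rcases (nsq_nonneg v).lt_or_eq with h | h
  · positivity
  · rw [← h, nsq_eq_zero.1 h.symm]
    have := ballBump_zero_pos
    positivity

theorem normSq_bumpNum (v : Fin 3 → ℝ) :
    Quaternion.normSq (bumpNum v) = (nsq v + ballBump v ^ 2) ^ 2 := by
  rw [Quaternion.normSq_def']
  simp only [bumpNum, quat, Pi.smul_apply, smul_eq_mul, nsq]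
  ring

theorem bumpNum_ne_zero (v : Fin 3 → ℝ) : bumpNum v ≠ 0 := by
  rw [← Quaternion.normSq_ne_zero, normSq_bumpNum]
  exact pow_ne_zero _ (nsq_add_ballBump_pos v).ne'

theorem continuous_ballBump : Continuous ballBump :=
  (expNegInvGlue.contDiff (n := 0)).continuous.comp (continuous_const.sub continuous_nsq)

theorem continuous_bumpNum : Continuous bumpNum := by
  have h1 := continuous_ballBump
  have h2 := continuous_nsq
  exact continuous_quat.comp ((h2.sub (h1.pow 2)).prodMk ((h1.const_mul 2).smul continuous_id))

/-- A degree one map from the unit ball to the unit quaternions, constant on the boundary. -/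
noncomputable def bump (v : Fin 3 → ℝ) : unitary ℍ := unitQuat (bumpNum v)

theorem continuous_bump : Continuous bump := continuous_unitQuat continuous_bumpNum bumpNum_ne_zero

theorem bump_eq_one_of_one_le_nsq {v : Fin 3 → ℝ} (h : 1 ≤ nsq v) : bump v = 1 := by
  have h2 : bumpNum v = (nsq v : ℍ) := by
    rw [bumpNum, ballBump_eq_zero h]
    ext <;> simp [quat]
  rw [bump, h2, unitQuat_coe_of_pos (by linarith)]

theorem bump_eq_one {v : Fin 3 → ℝ} (hv : 1 ≤ ‖v‖) : bump v = 1 :=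
  bump_eq_one_of_one_le_nsq (one_le_nsq hv)

/-- The map of the unit quaternions which blows up a neighbourhood of `-1`. -/
noncomputable def blowUp (δ : ℝ) (z : unitary ℍ) : unitary ℍ :=
  if (z : ℍ).re ≤ 0 then bump (δ⁻¹ • imVec z) else 1

theorem re_sq_add_nsq_imVec (z : unitary ℍ) : (z : ℍ).re ^ 2 + nsq (imVec z) = 1 := by
  have h := Quaternion.normSq_eq_norm_mul_self (z : ℍ)
  rw [norm_unitary_quaternion, Quaternion.normSq_def'] at h
  simp only [nsq, imVec]
  simp
  linarith

theorem nsq_smul (r : ℝ) (v : Fin 3 → ℝ) : nsq (r • v) = r ^ 2 * nsq v := by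
  simp only [nsq, Pi.smul_apply, smul_eq_mul]; ring

theorem continuous_blowUp {δ : ℝ} (h0 : 0 < δ) (h1 : δ ≤ 1) : Continuous (blowUp δ) := by
  have h : Continuous fun z : unitary ℍ ↦ δ⁻¹ • imVec z :=
    (continuous_imVec.comp continuous_subtype_val).const_smul δ⁻¹
  refine Continuous.if_le (continuous_bump.comp h) continuous_const
    (Quaternion.continuous_re.comp continuous_subtype_val) continuous_const fun z hz ↦ ?_
  have h2 := re_sq_add_nsq_imVec z
  rw [hz] at h2
  refine bump_eq_one_of_one_le_nsq ?_
  rw [nsq_smul, show nsq (imVec z) = 1 by linarith, mul_one]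
  exact one_le_pow₀ (one_le_inv_iff₀.2 ⟨h0, h1⟩)

theorem blowUp_ne_neg {δ : ℝ} (h0 : 0 < δ) (z : unitary ℍ) : (blowUp δ z : ℍ) ≠ -z := fun h ↦ by
  rw [blowUp] at h
  split_ifs at h with hz
  · rw [bump, coe_unitQuat (bumpNum_ne_zero _)] at h
    have hk : 0 < ‖bumpNum (δ⁻¹ • imVec z)‖⁻¹ := inv_pos.2 (norm_pos_iff.2 (bumpNum_ne_zero _))
    generalize ‖bumpNum (δ⁻¹ • imVec z)‖⁻¹ = k at h hk
    have hb := ballBump_nonneg (δ⁻¹ • imVec z)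
    have hb0 : imVec z = 0 → 0 < ballBump (δ⁻¹ • imVec z) := fun h ↦ by
      rw [h, smul_zero]; exact ballBump_zero_pos
    have hre := congrArg QuaternionAlgebra.re h
    have hI := congrArg QuaternionAlgebra.imI h
    have hJ := congrArg QuaternionAlgebra.imJ h
    have hK := congrArg QuaternionAlgebra.imK h
    have h4 := re_sq_add_nsq_imVec z
    unfold bumpNum at hre hI hJ hK
    generalize ballBump (δ⁻¹ • imVec z) = b at hb hb0 hre hI hJ hK
    rw [Quaternion.re_smul, Quaternion.re_neg] at hre
    rw [Quaternion.imI_smul, Quaternion.imI_neg] at hI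
    rw [Quaternion.imJ_smul, Quaternion.imJ_neg] at hJ
    rw [Quaternion.imK_smul, Quaternion.imK_neg] at hK
    have h2 : imVec z = 0 := by
      have h3 : (k * (2 * b * δ⁻¹) + 1) • imVec z = 0 := by
        ext i
        fin_cases i <;> simp [quat, imVec, -mul_eq_zero] at hI hJ hK ⊢ <;> linarith
      exact (smul_eq_zero.1 h3).resolve_left (by positivity)
    have h6 := hb0 h2
    rw [h2, nsq_eq_zero.2 rfl] at h4
    have h5 : (z : ℍ).re = -1 := by nlinarith
    have h7 : 0 < k * b ^ 2 := by positivity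
    simp [quat, h2, h5, nsq_eq_zero.2 rfl] at hre
    linarith
  · have := congrArg QuaternionAlgebra.re h
    simp at this
    linarith

end Bump

section Affine

open Matrix

theorem cubeSupported_bump {w : (Fin 3 → ℝ) → Fin 3 → ℝ} (hw : Continuous w)
    (hb : ∀ x : Fin 3 → ℝ, (∃ i, x i ≤ 0 ∨ 1 ≤ x i) → 1 ≤ ‖w x‖) :
    CubeSupported fun x ↦ bump (w x) :=
  ⟨continuous_bump.comp hw, fun x hx ↦ bump_eq_one (hb x hx)⟩

theorem cubeClass_bump_eq (w : ℝ → (Fin 3 → ℝ) → Fin 3 → ℝ)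
    (hw : Continuous fun z : ℝ × (Fin 3 → ℝ) ↦ w z.1 z.2)
    (hb : ∀ t, 0 ≤ t → t ≤ 1 → ∀ x : Fin 3 → ℝ, (∃ i, x i ≤ 0 ∨ 1 ≤ x i) → 1 ≤ ‖w t x‖) :
    cubeClass (fun x ↦ bump (w 0 x)) = cubeClass (fun x ↦ bump (w 1 x)) := by
  have := cubeClass_eq_of_homotopy (fun (t : I) x ↦ bump (w t x))
    (continuous_bump.comp (hw.comp (by fun_prop :
      Continuous fun z : I × (Fin 3 → ℝ) ↦ ((z.1 : ℝ), z.2))))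
    fun t x hx ↦ bump_eq_one (hb t t.2.1 t.2.2 x hx)
  simpa using this

/-- The sum of the absolute values of the entries. -/
def absSum (M : Matrix (Fin 3) (Fin 3) ℝ) : ℝ := ∑ i, ∑ j, |M i j|

theorem absSum_nonneg (M : Matrix (Fin 3) (Fin 3) ℝ) : 0 ≤ absSum M :=
  Finset.sum_nonneg fun _ _ ↦ Finset.sum_nonneg fun _ _ ↦ abs_nonneg _

theorem norm_mulVec_le_absSum (M : Matrix (Fin 3) (Fin 3) ℝ) (v : Fin 3 → ℝ) :
    ‖M *ᵥ v‖ ≤ absSum M * ‖v‖ := by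
  refine (pi_norm_le_iff_of_nonneg (mul_nonneg (absSum_nonneg M) (norm_nonneg v))).2 fun i ↦ ?_
  calc ‖(M *ᵥ v) i‖ ≤ ∑ j, ‖M i j * v j‖ := norm_sum_le Finset.univ fun j ↦ M i j * v j
    _ ≤ ∑ j, |M i j| * ‖v‖ := Finset.sum_le_sum fun j _ ↦ by
        rw [norm_mul, Real.norm_eq_abs]
        exact mul_le_mul_of_nonneg_left (norm_le_pi_norm v j) (abs_nonneg _)
    _ = (∑ j, |M i j|) * ‖v‖ := (Finset.sum_mul ..).symm
    _ ≤ absSum M * ‖v‖ := mul_le_mul_of_nonneg_right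
        (Finset.single_le_sum (f := fun i ↦ ∑ j, |M i j|)
          (fun _ _ ↦ Finset.sum_nonneg fun _ _ ↦ abs_nonneg _) (Finset.mem_univ i))
        (norm_nonneg v)

/-- A scaling factor making an invertible matrix expand by a factor of at least two. -/
noncomputable def expandFactor (M : Matrix (Fin 3) (Fin 3) ℝ) : ℝ :=
  2 * absSum M.adjugate / |M.det|

theorem expandFactor_nonneg (M : Matrix (Fin 3) (Fin 3) ℝ) : 0 ≤ expandFactor M :=
  div_nonneg (mul_nonneg two_pos.le (absSum_nonneg _)) (abs_nonneg _)

theorem two_mul_norm_le {M : Matrix (Fin 3) (Fin 3) ℝ} (hM : M.det ≠ 0) (v : Fin 3 → ℝ) :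
    2 * ‖v‖ ≤ expandFactor M * ‖M *ᵥ v‖ := by
  have h := norm_mulVec_le_absSum M.adjugate (M *ᵥ v)
  rw [mulVec_mulVec, adjugate_mul, smul_mulVec, one_mulVec, norm_smul, Real.norm_eq_abs] at h
  have := abs_pos.2 hM
  rw [expandFactor, div_mul_eq_mul_div, le_div_iff₀ this]
  linarith

/-- The centre of the unit cube. -/
noncomputable def cubeCenter : Fin 3 → ℝ := fun _ ↦ 1 / 2

theorem half_le_norm_sub_cubeCenter {x : Fin 3 → ℝ} (hx : ∃ i, x i ≤ 0 ∨ 1 ≤ x i) :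
    1 / 2 ≤ ‖x - cubeCenter‖ := by
  obtain ⟨i, hi⟩ := hx
  refine le_trans ?_ (norm_le_pi_norm (x - cubeCenter) i)
  rw [Pi.sub_apply, cubeCenter, Real.norm_eq_abs, le_abs]
  rcases hi with hi | hi
  · right; linarith
  · left; linarith

/-- The class of a bump function with linear part a positive multiple of the given matrix. -/
noncomputable def bumpClass (M : Matrix (Fin 3) (Fin 3) ℝ) : π_ 3 (unitary ℍ) 1 :=
  cubeClass fun x ↦ bump (expandFactor M • M *ᵥ (x - cubeCenter))

theorem cubeClass_bump_smul {M : Matrix (Fin 3) (Fin 3) ℝ} (hM : M.det ≠ 0) {s : ℝ} (hs : 0 ≤ s)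
    (h : ∀ v : Fin 3 → ℝ, 1 / 2 ≤ ‖v‖ → 1 ≤ s * ‖M *ᵥ v‖) :
    cubeClass (fun x ↦ bump (s • M *ᵥ (x - cubeCenter))) = bumpClass M := by
  have := cubeClass_bump_eq
    (fun t x ↦ ((1 - t) * s + t * expandFactor M) • M *ᵥ (x - cubeCenter)) (by fun_prop)
    fun t h0 h1 x hx ↦ by
      have h3 := half_le_norm_sub_cubeCenter hx
      have h4 := h _ h3
      have h5 := two_mul_norm_le hM (x - cubeCenter)
      have h6 : 0 ≤ (1 - t) * s := mul_nonneg (by linarith) hs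
      have h7 : 0 ≤ t * expandFactor M := mul_nonneg h0 (expandFactor_nonneg M)
      rw [norm_smul, Real.norm_of_nonneg (by linarith)]
      nlinarith
  simpa [bumpClass] using this

theorem bumpClass_eq_of_path (A : ℝ → Matrix (Fin 3) (Fin 3) ℝ) (hA : Continuous A)
    (h : ∀ t, 0 ≤ t → t ≤ 1 → (A t).det ≠ 0) : bumpClass (A 0) = bumpClass (A 1) := by
  set B : ℝ → Matrix (Fin 3) (Fin 3) ℝ := fun t ↦ A (min 1 (max 0 t))
  have hB : Continuous B := by fun_prop
  have hd (t) : (B t).det ≠ 0 := h _ (by simp) (by simp)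
  have he : Continuous fun t ↦ expandFactor (B t) := by
    refine Continuous.div ?_ hB.matrix_det.abs fun t ↦ abs_ne_zero.2 (hd t)
    refine continuous_const.mul
      (continuous_finsetSum _ fun i _ ↦ continuous_finsetSum _ fun j _ ↦ ?_)
    exact (hB.matrix_adjugate.matrix_elem i j).abs
  have := cubeClass_bump_eq (fun t x ↦ expandFactor (B t) • B t *ᵥ (x - cubeCenter))
    ((he.comp continuous_fst).smul (((hB.comp continuous_fst).matrix_mulVec
      (continuous_snd.sub continuous_const))))
    fun t _ _ x hx ↦ by
      rw [norm_smul, Real.norm_of_nonneg (expandFactor_nonneg _)]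
      linarith [half_le_norm_sub_cubeCenter hx, two_mul_norm_le (hd t) (x - cubeCenter)]
  simpa [bumpClass, B] using this

/-- The diagonal matrix with one prescribed entry and the others equal to one. -/
def diagUpdate (i : Fin 3) (a : ℝ) : Matrix (Fin 3) (Fin 3) ℝ :=
  diagonal (Function.update 1 i a)

theorem det_diagUpdate (i : Fin 3) (a : ℝ) : (diagUpdate i a).det = a := by
  rw [diagUpdate, det_diagonal, Finset.prod_update_of_mem (Finset.mem_univ i)]
  simp

theorem diagUpdate_neg_one_mulVec (i : Fin 3) (v : Fin 3 → ℝ) :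
    diagUpdate i (-1) *ᵥ v = Function.update v i (-v i) := by
  ext j
  rw [diagUpdate, mulVec_diagonal]
  by_cases h : j = i
  · subst h; simp
  · simp [h]

theorem norm_update_neg (i : Fin 3) (v : Fin 3 → ℝ) : ‖Function.update v i (-v i)‖ = ‖v‖ := by
  have h (j) : ‖Function.update v i (-v i) j‖₊ = ‖v j‖₊ := by
    by_cases h : j = i
    · subst h; simp
    · simp [h]
  simp only [Pi.norm_def, h]

theorem bumpClass_mul_diagUpdate_neg_one {M : Matrix (Fin 3) (Fin 3) ℝ} (hM : M.det ≠ 0)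
    (i : Fin 3) : bumpClass (M * diagUpdate i (-1)) = (bumpClass M)⁻¹ := by
  set s := expandFactor (M * diagUpdate i (-1))
  have h (v : Fin 3 → ℝ) (hv : 1 / 2 ≤ ‖v‖) : 1 ≤ s * ‖M *ᵥ v‖ := by
    have h1 := two_mul_norm_le (M := M * diagUpdate i (-1))
      (by rw [det_mul, det_diagUpdate]; exact mul_ne_zero hM (by norm_num))
      (Function.update v i (-v i))
    rw [← mulVec_mulVec, diagUpdate_neg_one_mulVec, norm_update_neg] at h1
    simp only [Function.update_idem, Function.update_self, neg_neg, Function.update_eq_self] at h1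
    linarith
  have hs := expandFactor_nonneg (M * diagUpdate i (-1))
  rw [← cubeClass_bump_smul hM hs h, ← cubeClass_reflect i (cubeSupported_bump (by fun_prop) _)]
  · refine congrArg cubeClass (funext fun x ↦ ?_)
    rw [← mulVec_mulVec, diagUpdate_neg_one_mulVec]
    congr 3
    ext j
    by_cases hj : j = i
    · subst hj
      simp only [Function.update_self, Pi.sub_apply, cubeCenter, if_true]
      ring
    · simp [hj]
  · intro x hx
    rw [norm_smul, Real.norm_of_nonneg hs]
    exact h _ (half_le_norm_sub_cubeCenter hx)

theorem bumpClass_mul_diagUpdate {M : Matrix (Fin 3) (Fin 3) ℝ} (hM : M.det ≠ 0)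
    (i : Fin 3) {a : ℝ} (ha : a ≠ 0) :
    bumpClass (M * diagUpdate i a) = bumpClass M ∨
      bumpClass (M * diagUpdate i a) = (bumpClass M)⁻¹ := by
  have key (b : ℝ) (hb : ∀ t, 0 ≤ t → t ≤ 1 → (1 - t) * a + t * b ≠ 0) :
      bumpClass (M * diagUpdate i a) = bumpClass (M * diagUpdate i b) := by
    have := bumpClass_eq_of_path (fun t ↦ M * diagUpdate i ((1 - t) * a + t * b))
      (continuous_const.matrix_mul (Continuous.matrix_diagonal
        (continuous_const.update i (by fun_prop))))
      fun t h0 h1 ↦ by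
        rw [det_mul, det_diagUpdate]
        exact mul_ne_zero hM (hb t h0 h1)
    simpa using this
  rcases ha.lt_or_gt with ha | ha
  · right
    rw [key (-1) fun t h0 h1 h ↦ by
      obtain rfl | h0 := h0.eq_or_lt
      · linarith
      · nlinarith, bumpClass_mul_diagUpdate_neg_one hM]
  · left
    rw [key 1 fun t h0 h1 h ↦ by
      obtain rfl | h0 := h0.eq_or_lt
      · linarith
      · nlinarith, diagUpdate]
    simp

theorem bumpClass_mul_eq_or {A : Matrix (Fin 3) (Fin 3) ℝ} (hA : A.det ≠ 0) :
    ∀ M : Matrix (Fin 3) (Fin 3) ℝ, M.det ≠ 0 →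
      bumpClass (M * A) = bumpClass M ∨ bumpClass (M * A) = (bumpClass M)⁻¹ := by
  have hmul (A B : Matrix (Fin 3) (Fin 3) ℝ) (hA : A.det ≠ 0)
      (h1 : ∀ M : Matrix (Fin 3) (Fin 3) ℝ, M.det ≠ 0 →
        bumpClass (M * A) = bumpClass M ∨ bumpClass (M * A) = (bumpClass M)⁻¹)
      (h2 : ∀ M : Matrix (Fin 3) (Fin 3) ℝ, M.det ≠ 0 →
        bumpClass (M * B) = bumpClass M ∨ bumpClass (M * B) = (bumpClass M)⁻¹)
      (M : Matrix (Fin 3) (Fin 3) ℝ) (hM : M.det ≠ 0) :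
      bumpClass (M * (A * B)) = bumpClass M ∨ bumpClass (M * (A * B)) = (bumpClass M)⁻¹ := by
    rw [← mul_assoc]
    rcases h1 M hM with h1 | h1 <;>
      rcases h2 (M * A) (by rw [det_mul]; exact mul_ne_zero hM hA) with h2 | h2 <;>
      simp [h1, h2]
  refine diagonal_transvection_induction_of_det_ne_zero (fun A ↦
    ∀ M : Matrix (Fin 3) (Fin 3) ℝ, M.det ≠ 0 →
      bumpClass (M * A) = bumpClass M ∨ bumpClass (M * A) = (bumpClass M)⁻¹) A hA
    (fun D hD ↦ ?_) (fun t M hM ↦ ?_) fun A B hA _ h1 h2 ↦ hmul A B hA h1 h2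
  · rw [det_diagonal, Finset.prod_ne_zero_iff] at hD
    have h : diagonal D = diagUpdate 0 (D 0) * (diagUpdate 1 (D 1) * diagUpdate 2 (D 2)) := by
      simp only [diagUpdate, diagonal_mul_diagonal]
      congr 1
      ext i
      fin_cases i <;> simp
    have hu (i) (M : Matrix (Fin 3) (Fin 3) ℝ) (hM : M.det ≠ 0) :=
      bumpClass_mul_diagUpdate hM i (hD i (Finset.mem_univ i))
    have hd (i) : (diagUpdate i (D i)).det ≠ 0 := by
      rw [det_diagUpdate]; exact hD i (Finset.mem_univ i)
    rw [h]
    exact hmul _ _ (hd 0) (hu 0) (hmul _ _ (hd 1) (hu 1) (hu 2))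
  · left
    have := bumpClass_eq_of_path (fun s ↦ M * transvection t.i t.j (s * t.c))
      (by simp only [transvection, ← smul_eq_mul, ← smul_single]; fun_prop) fun s _ _ ↦ by
        rw [det_mul, det_transvection_of_ne _ _ t.hij, mul_one]
        exact hM
    simp only [zero_mul, transvection_zero, mul_one, one_mul] at this
    rw [this, TransvectionStruct.toMatrix]

theorem bumpClass_mem_zpowers {A : Matrix (Fin 3) (Fin 3) ℝ} (hA : A.det ≠ 0) :
    bumpClass A ∈ Subgroup.zpowers (bumpClass 1) := by
  have h := bumpClass_mul_eq_or hA 1 (by simp)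
  rw [one_mul] at h
  rcases h with h | h <;> rw [h]
  · exact Subgroup.mem_zpowers _
  · exact inv_mem (Subgroup.mem_zpowers _)

end Affine

section Local

open Matrix

theorem blowUp_eq_one {δ : ℝ} (h0 : 0 < δ) (h1 : δ ≤ 1) {z : unitary ℍ}
    (h : δ ≤ 1 + (z : ℍ).re) : blowUp δ z = 1 := by
  rw [blowUp]
  split_ifs with hz
  · refine bump_eq_one_of_one_le_nsq ?_
    have := re_sq_add_nsq_imVec z
    rw [nsq_smul, inv_pow, inv_mul_eq_div, one_le_div (by positivity)]
    nlinarith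
  · rfl

theorem expandFactor_pos {M : Matrix (Fin 3) (Fin 3) ℝ} (hM : M.det ≠ 0) :
    0 < expandFactor M := by
  refine (expandFactor_nonneg M).lt_of_ne fun h ↦ ?_
  have := two_mul_norm_le hM 1
  rw [← h, zero_mul, norm_one] at this
  linarith

theorem le_norm_sub_of_not_mem_cube {p x : Fin 3 → ℝ} {r : ℝ} (hp : ∀ i, r ≤ p i ∧ p i + r ≤ 1)
    (hx : ∃ i, x i ≤ 0 ∨ 1 ≤ x i) : r ≤ ‖x - p‖ := by
  obtain ⟨i, hi⟩ := hx
  refine le_trans ?_ (norm_le_pi_norm (x - p) i)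
  have := hp i
  rw [Pi.sub_apply, Real.norm_eq_abs, le_abs]
  rcases hi with hi | hi
  · right; linarith
  · left; linarith

theorem cubeClass_bump_affine {A : Matrix (Fin 3) (Fin 3) ℝ} (hA : A.det ≠ 0)
    {p : Fin 3 → ℝ} {r s : ℝ} (hs : 0 ≤ s) (hp : ∀ i, r ≤ p i ∧ p i + r ≤ 1)
    (h : ∀ v : Fin 3 → ℝ, r ≤ ‖v‖ → 1 ≤ s * ‖A *ᵥ v‖) :
    cubeClass (fun x ↦ bump (s • A *ᵥ (x - p))) = bumpClass A := by
  have hr : r ≤ 1 / 2 := by linarith [hp 0]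
  have := cubeClass_bump_eq
    (fun t x ↦ s • A *ᵥ (x - ((1 - t) • p + t • cubeCenter))) (by fun_prop)
    fun t h0 h1 x hx ↦ by
      rw [norm_smul, Real.norm_of_nonneg hs]
      refine h _ (le_norm_sub_of_not_mem_cube (fun i ↦ ?_) hx)
      have := hp i
      simp only [Pi.add_apply, Pi.smul_apply, smul_eq_mul, cubeCenter]
      constructor <;> nlinarith
  simp only [sub_zero, one_smul, zero_smul, add_zero, sub_self, zero_add] at this
  rw [this]
  exact cubeClass_bump_smul hA hs fun v hv ↦ h v (hr.trans hv)

theorem cubeClass_bump_local {A : Matrix (Fin 3) (Fin 3) ℝ} (hA : A.det ≠ 0)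
    {w : (Fin 3 → ℝ) → Fin 3 → ℝ} (hw : Continuous w) {p : Fin 3 → ℝ} {r δ : ℝ}
    (hp : ∀ i, r ≤ p i ∧ p i + r ≤ 1) (hδ : 0 < δ) (hδr : δ ≤ (expandFactor A)⁻¹ * r)
    (h : ∀ x, dist x p ≤ r → ‖w x - A *ᵥ (x - p)‖ ≤ (expandFactor A)⁻¹ * ‖x - p‖) :
    CubeSupported (fun x ↦ if dist x p ≤ r then bump (δ⁻¹ • w x) else 1) ∧
    cubeClass (fun x ↦ if dist x p ≤ r then bump (δ⁻¹ • w x) else 1) = bumpClass A := by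
  set κ := (expandFactor A)⁻¹
  have hκ : 0 < κ := inv_pos.2 (expandFactor_pos hA)
  have hr : 0 < r := by
    by_contra! hr
    nlinarith
  have hAv (v : Fin 3 → ℝ) : 2 * κ * ‖v‖ ≤ ‖A *ᵥ v‖ := by
    have := two_mul_norm_le hA v
    rw [mul_comm 2 κ, mul_assoc, inv_mul_le_iff₀ (expandFactor_pos hA)]
    exact this
  have hexp (v : Fin 3 → ℝ) (hv : r ≤ ‖v‖) : 1 ≤ δ⁻¹ * ‖A *ᵥ v‖ := by
    rw [inv_mul_eq_div, one_le_div hδ]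
    nlinarith [hAv v]
  set H : I → (Fin 3 → ℝ) → unitary ℍ := fun t x ↦
    if dist x p ≤ r then bump (δ⁻¹ • ((1 - t : ℝ) • w x + (t : ℝ) • A *ᵥ (x - p))) else 1
  have hsph (t : I) (x : Fin 3 → ℝ) (hx : dist x p = r) :
      bump (δ⁻¹ • ((1 - t : ℝ) • w x + (t : ℝ) • A *ᵥ (x - p))) = 1 := by
    refine bump_eq_one ?_
    have h1 : (1 - t : ℝ) • w x + (t : ℝ) • A *ᵥ (x - p) =
        A *ᵥ (x - p) + (1 - t : ℝ) • (w x - A *ᵥ (x - p)) := by module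
    have h2 := norm_sub_le_norm_add (A *ᵥ (x - p)) ((1 - t : ℝ) • (w x - A *ᵥ (x - p)))
    have h3 := h x hx.le
    have h4 := hAv (x - p)
    rw [norm_smul, Real.norm_of_nonneg (by linarith [t.2.2])] at h2
    rw [norm_smul, norm_inv, Real.norm_of_nonneg hδ.le, inv_mul_eq_div, one_le_div hδ, h1]
    rw [dist_eq_norm] at hx
    rw [hx] at h3 h4
    nlinarith [t.2.1, t.2.2, norm_nonneg (w x - A *ᵥ (x - p))]
  have hc : Continuous fun z : I × (Fin 3 → ℝ) ↦ H z.1 z.2 :=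
    Continuous.if_le (continuous_bump.comp (by fun_prop)) continuous_const (by fun_prop)
      continuous_const fun z hz ↦ hsph z.1 z.2 hz
  have hb (t : I) (x : Fin 3 → ℝ) (hx : ∃ i, x i ≤ 0 ∨ 1 ≤ x i) : H t x = 1 := by
    have h1 := le_norm_sub_of_not_mem_cube hp hx
    rw [← dist_eq_norm] at h1
    simp only [H]
    split_ifs with h2
    · exact hsph t x (h2.antisymm h1)
    · rfl
  have hH0 : H 0 = fun x ↦ if dist x p ≤ r then bump (δ⁻¹ • w x) else 1 := by
    simp [H]
  have hH1 : H 1 = fun x ↦ bump (δ⁻¹ • A *ᵥ (x - p)) := by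
    funext x
    simp only [H, Set.Icc.coe_one, sub_self, zero_smul, one_smul, zero_add]
    split_ifs with hx
    · rfl
    · refine (bump_eq_one ?_).symm
      rw [norm_smul, norm_inv, Real.norm_of_nonneg hδ.le]
      exact hexp _ (by rw [← dist_eq_norm]; linarith)
  rw [← hH0]
  refine ⟨⟨hc.comp (Continuous.prodMk_right 0), hb 0⟩, ?_⟩
  rw [cubeClass_eq_of_homotopy H hc hb, hH1]
  exact cubeClass_bump_affine hA (inv_pos.2 hδ).le hp hexp

theorem one_add_re_pos {z : unitary ℍ} (hz : z ≠ -1) : 0 < 1 + (z : ℍ).re := by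
  have h := re_sq_add_nsq_imVec z
  have h0 := nsq_nonneg (imVec z)
  by_contra! h1
  have h2 : (z : ℍ).re = -1 := by nlinarith
  have h3 : imVec z = 0 := nsq_eq_zero.1 (by nlinarith)
  refine hz (Subtype.ext ?_)
  rw [Unitary.coe_neg, OneMemClass.coe_one]
  ext
  · simp [h2]
  · simpa [imVec] using congrFun h3 0
  · simpa [imVec] using congrFun h3 1
  · simpa [imVec] using congrFun h3 2

theorem eventually_lt_nhdsGT_zero {a : ℝ} (ha : 0 < a) : ∀ᶠ r in 𝓝[>] (0 : ℝ), r < a :=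
  (eventually_lt_nhds ha).filter_mono nhdsWithin_le_nhds

theorem eventually_forall_dist_le {X : Type*} [PseudoMetricSpace X] {Q : X → Prop} {p : X}
    (h : ∀ᶠ x in 𝓝 p, Q x) : ∀ᶠ r in 𝓝[>] (0 : ℝ), ∀ x, dist x p ≤ r → Q x := by
  obtain ⟨ε, hε, h⟩ := Metric.eventually_nhds_iff.1 h
  filter_upwards [eventually_lt_nhdsGT_zero hε] with r hr x hx using h (hx.trans_lt hr)

theorem isolated_preimage {W : (Fin 3 → ℝ) → unitary ℍ} {p : Fin 3 → ℝ}
    {A : Matrix (Fin 3) (Fin 3) ℝ} (hA : A.det ≠ 0)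
    (h : HasFDerivAt (fun x ↦ imVec (W x)) (toLin' A).toContinuousLinearMap p) :
    ∀ᶠ x in 𝓝[≠] p, W x ≠ -1 := by
  have := h.eventually_ne (c := 0) ⟨(expandFactor A).toNNReal,
    AddMonoidHomClass.antilipschitz_of_bound _ fun v ↦ by
      have := two_mul_norm_le hA v
      rw [Real.coe_toNNReal _ (expandFactor_nonneg A)]
      simp
      linarith [norm_nonneg v]⟩
  filter_upwards [this] with x hx h
  apply hx
  rw [h]
  ext i
  fin_cases i <;> simp [imVec, Unitary.coe_neg]

theorem cubeClass_blowUp_mem {W : (Fin 3 → ℝ) → unitary ℍ} (hW : Continuous W) {c : unitary ℍ}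
    (hc : c ≠ -1) (hWc : ∀ x : Fin 3 → ℝ, (∃ i, x i ≤ 0 ∨ 1 ≤ x i) → W x = c)
    (A : (Fin 3 → ℝ) → Matrix (Fin 3) (Fin 3) ℝ) (hA : ∀ p, W p = -1 → (A p).det ≠ 0)
    (hAd : ∀ p, W p = -1 →
      HasFDerivAt (fun x ↦ imVec (W x)) (toLin' (A p)).toContinuousLinearMap p) :
    ∃ δ, 0 < δ ∧ δ ≤ 1 ∧ blowUp δ c = 1 ∧
      cubeClass (fun x ↦ blowUp δ (W x)) ∈ Subgroup.zpowers (bumpClass 1) := by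
  set P := {p | W p = -1}
  have hP (p) (hp : p ∈ P) (i) : 0 < p i ∧ p i < 1 := by
    by_contra! h
    refine hc ((hWc p ⟨i, ?_⟩).symm.trans hp)
    by_contra! h2
    linarith [h h2.1]
  have hcompact : IsCompact P :=
    (isCompact_Icc (a := (0 : Fin 3 → ℝ)) (b := 1)).of_isClosed_subset
      (isClosed_singleton.preimage hW) fun p hp ↦
        ⟨fun i ↦ (hP p hp i).1.le, fun i ↦ (hP p hp i).2.le⟩
  have hfin : P.Finite := by
    refine hcompact.finite (isDiscrete_iff_nhdsNE.2 fun p hp ↦ ?_)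
    exact Filter.inf_principal_eq_bot.2 (isolated_preimage (hA p hp) (hAd p hp))
  have hr : ∀ᶠ r in 𝓝[>] (0 : ℝ), 0 < r ∧ ∀ p ∈ P, (∀ i, r ≤ p i ∧ p i + r ≤ 1) ∧
      (∀ x, dist x p ≤ r → (W x : ℍ).re ≤ 0) ∧
      (∀ x, dist x p ≤ r →
        ‖imVec (W x) - A p *ᵥ (x - p)‖ ≤ (expandFactor (A p))⁻¹ * ‖x - p‖) ∧
      ∀ q ∈ P, q ≠ p → 2 * r < dist p q := by
    refine Filter.Eventually.and self_mem_nhdsWithin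
      ((Filter.eventually_all_finite hfin).2 fun p hp ↦ ?_)
    refine (Filter.eventually_all.2 fun i ↦ ?_).and <| .and ?_ <| .and ?_ <|
      (Filter.eventually_all_finite hfin).2 fun q hq ↦ ?_
    · filter_upwards [eventually_lt_nhdsGT_zero (hP p hp i).1,
        eventually_lt_nhdsGT_zero (sub_pos.2 (hP p hp i).2)] with r h1 h2
      constructor <;> linarith
    · refine eventually_forall_dist_le ?_
      have h : Continuous fun x ↦ (W x : ℍ).re :=
        Quaternion.continuous_re.comp (continuous_subtype_val.comp hW)
      have hp' : (W p : ℍ).re < 0 := by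
        rw [show W p = -1 from hp, Unitary.coe_neg]
        simp
      filter_upwards [(h.tendsto p).eventually (eventually_lt_nhds hp')] with x hx using hx.le
    · refine eventually_forall_dist_le ?_
      have hp' : imVec (W p) = 0 := by
        rw [show W p = -1 from hp]
        ext i
        fin_cases i <;> simp [imVec, Unitary.coe_neg]
      have := (hAd p hp).isLittleO.def (inv_pos.2 (expandFactor_pos (hA p hp)))
      simpa [hp'] using this
    · by_cases hqp : q = p
      · simp [hqp]
      filter_upwards [eventually_lt_nhdsGT_zero (half_pos (dist_pos.2 (Ne.symm hqp)))] with r hr _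
      linarith
  obtain ⟨r, hr0, hr⟩ := hr.exists
  obtain ⟨m, hm0, hm⟩ : ∃ m > 0, ∀ x, (∀ p ∈ P, r < dist x p) → m ≤ 1 + (W x : ℍ).re := by
    have hcont : Continuous fun x ↦ 1 + (W x : ℍ).re :=
      continuous_const.add (Quaternion.continuous_re.comp (continuous_subtype_val.comp hW))
    have hK : IsCompact (Set.Icc (0 : Fin 3 → ℝ) 1 ∩ {x | ∀ p ∈ P, r ≤ dist x p}) := by
      refine isCompact_Icc.inter_right ?_
      simp only [Set.ofPred_forall]
      exact isClosed_biInter fun p _ ↦ isClosed_le continuous_const (by fun_prop)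
    obtain ⟨m, hm0, hm⟩ := hK.exists_forall_le' hcont.continuousOn (a := 0) fun x hx ↦
      one_add_re_pos fun h ↦ by
        have := hx.2 x h
        rw [dist_self] at this
        linarith
    refine ⟨min m (1 + (c : ℍ).re), lt_min hm0 (one_add_re_pos hc), fun x hx ↦ ?_⟩
    by_cases hx' : ∃ i, x i ≤ 0 ∨ 1 ≤ x i
    · rw [hWc x hx']
      exact min_le_right _ _
    · push Not at hx'
      exact (min_le_left _ _).trans
        (hm x ⟨⟨fun i ↦ (hx' i).1.le, fun i ↦ (hx' i).2.le⟩, fun p hp ↦ (hx p hp).le⟩)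
  have hδ : ∀ᶠ δ in 𝓝[>] (0 : ℝ), 0 < δ ∧ δ ≤ 1 ∧ δ ≤ m ∧ δ ≤ 1 + (c : ℍ).re ∧
      ∀ p ∈ P, δ ≤ (expandFactor (A p))⁻¹ * r := by
    refine Filter.Eventually.and self_mem_nhdsWithin <| .and ?_ <| .and ?_ <| .and ?_ <|
      (Filter.eventually_all_finite hfin).2 fun p hp ↦ ?_
    · exact (eventually_lt_nhdsGT_zero one_pos).mono fun _ ↦ le_of_lt
    · exact (eventually_lt_nhdsGT_zero hm0).mono fun _ ↦ le_of_lt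
    · exact (eventually_lt_nhdsGT_zero (one_add_re_pos hc)).mono fun _ ↦ le_of_lt
    · exact (eventually_lt_nhdsGT_zero
        (mul_pos (inv_pos.2 (expandFactor_pos (hA p hp))) hr0)).mono fun _ ↦ le_of_lt
  obtain ⟨δ, hδ0, hδ1, hδm, hδc, hδ⟩ := hδ.exists
  refine ⟨δ, hδ0, hδ1, blowUp_eq_one hδ0 hδ1 hδc, ?_⟩
  classical
  have key (T : Finset (Fin 3 → ℝ)) : (T : Set (Fin 3 → ℝ)) ⊆ P →
      CubeSupported (fun x ↦ if ∃ p ∈ T, dist x p ≤ r then bump (δ⁻¹ • imVec (W x)) else 1) ∧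
      cubeClass (fun x ↦ if ∃ p ∈ T, dist x p ≤ r then bump (δ⁻¹ • imVec (W x)) else 1) ∈
        Subgroup.zpowers (bumpClass 1) := by
    induction T using Finset.induction with
    | empty =>
      intro _
      simp only [Finset.notMem_empty, false_and, exists_false, if_false]
      have h1 : cubeClass (fun _ : Fin 3 → ℝ ↦ (1 : unitary ℍ)) = 1 := cubeClass_one
      exact ⟨CubeSupported.one, by rw [h1]; exact one_mem _⟩
    | insert p T hpT ih =>
      intro hT
      rw [Finset.coe_insert, Set.insert_subset_iff] at hT
      obtain ⟨h1, h2⟩ := ih hT.2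
      obtain ⟨h3, h4⟩ := cubeClass_bump_local (hA p hT.1) (w := fun x ↦ imVec (W x))
        (continuous_imVec.comp (continuous_subtype_val.comp hW)) (hr p hT.1).1 hδ0 (hδ p hT.1)
        (hr p hT.1).2.2.1
      have : (fun x ↦ if ∃ q ∈ insert p T, dist x q ≤ r then bump (δ⁻¹ • imVec (W x)) else 1) =
          (fun x ↦ if dist x p ≤ r then bump (δ⁻¹ • imVec (W x)) else 1) *
          fun x ↦ if ∃ p ∈ T, dist x p ≤ r then bump (δ⁻¹ • imVec (W x)) else 1 := by
        funext x
        simp only [Finset.exists_mem_insert, Pi.mul_apply]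
        by_cases hx : dist x p ≤ r
        · have : ¬ ∃ q ∈ T, dist x q ≤ r := fun ⟨q, hq, hxq⟩ ↦ by
            have := (hr p hT.1).2.2.2 q (hT.2 hq) fun h ↦ hpT (h ▸ hq)
            linarith [dist_triangle_left p q x]
          simp [hx, this]
        · simp [hx]
      rw [this]
      refine ⟨h3.mul h1, ?_⟩
      rw [cubeClass_mul h3 h1]
      exact mul_mem (h4 ▸ bumpClass_mem_zpowers (hA p hT.1)) h2
  have := (key hfin.toFinset (by simp)).2
  convert this using 2
  funext x
  simp only [Set.Finite.mem_toFinset]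
  split_ifs with hx
  · obtain ⟨p, hp, hx⟩ := hx
    rw [blowUp, if_pos ((hr p hp).2.1 x hx)]
  · push Not at hx
    exact blowUp_eq_one hδ0 hδ1 (hδm.trans (hm x hx))

end Local

section Smooth

open Matrix

theorem segment_ne_zero {z w : unitary ℍ} (h : w ≠ -z) {t : ℝ} (h0 : 0 ≤ t) (h1 : t ≤ 1) :
    (1 - t) • (z : ℍ) + t • (w : ℍ) ≠ 0 := fun h2 ↦ by
  have h3 := eq_neg_of_add_eq_zero_left h2
  have h4 := congrArg norm h3
  rw [norm_neg, norm_smul, norm_smul, norm_unitary_quaternion, norm_unitary_quaternion,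
    Real.norm_of_nonneg h0, Real.norm_of_nonneg (by linarith)] at h4
  have h5 : t = 1 / 2 := by linarith
  subst h5
  refine h (Subtype.ext ?_)
  rw [Unitary.coe_neg]
  have : (1 - 1 / 2 : ℝ) = 1 / 2 := by norm_num
  rw [this, ← smul_neg] at h3
  rw [smul_right_injective ℍ (by norm_num : (1 / 2 : ℝ) ≠ 0) h3, neg_neg]

theorem cubeClass_eq_of_ne_neg {F F' : (Fin 3 → ℝ) → unitary ℍ} (hF : Continuous F)
    (hF' : Continuous F') {c c' : unitary ℍ}
    (hc : ∀ x : Fin 3 → ℝ, (∃ i, x i ≤ 0 ∨ 1 ≤ x i) → F x = c)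
    (hc' : ∀ x : Fin 3 → ℝ, (∃ i, x i ≤ 0 ∨ 1 ≤ x i) → F' x = c')
    (h : ∀ x, F' x ≠ -F x) :
    cubeClass (fun x ↦ c⁻¹ * F x) = cubeClass fun x ↦ c'⁻¹ * F' x := by
  have hcc' : c' ≠ -c := by
    have hx : ∃ i : Fin 3, (0 : Fin 3 → ℝ) i ≤ 0 ∨ 1 ≤ (0 : Fin 3 → ℝ) i := ⟨0, by simp⟩
    rw [← hc 0 hx, ← hc' 0 hx]
    exact h 0
  have := cubeClass_eq_of_homotopy (fun (t : I) (x : Fin 3 → ℝ) ↦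
    (unitQuat ((1 - t : ℝ) • (c : ℍ) + (t : ℝ) • (c' : ℍ)))⁻¹ *
      unitQuat ((1 - t : ℝ) • (F x : ℍ) + (t : ℝ) • (F' x : ℍ)))
    ((continuous_unitQuat (by fun_prop) fun z ↦ segment_ne_zero hcc' z.1.2.1 z.1.2.2).inv.mul
      (continuous_unitQuat (by fun_prop) fun z ↦ segment_ne_zero (h z.2) z.1.2.1 z.1.2.2))
    fun t x hx ↦ by
      rw [hc x hx, hc' x hx, inv_mul_cancel]
  simpa [unitQuat_coe] using this

theorem exists_contDiff_unitary {E : Type*} [NormedAddCommGroup E] [NormedSpace ℝ E]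
    [FiniteDimensional ℝ E] (n : ℕ∞) {U : E → unitary ℍ} (hU : Continuous U)
    {S O : Set E} (hS : IsClosed S) (hO : O ∈ 𝓝ˢ S)
    (hUO : ContDiffOn ℝ n (fun x ↦ (U x : ℍ)) O) :
    ∃ G : E → unitary ℍ, ContDiff ℝ n (fun x ↦ (G x : ℍ)) ∧ Set.EqOn G U S ∧
      (∀ x, U x = 1 → G x = 1) ∧ ∀ x, G x ≠ -U x := by
  have hc : Continuous fun x ↦ (U x : ℍ) - 1 := by fun_prop
  obtain ⟨g, hg, hgd, hgS, hgs⟩ := hc.exists_contDiff_approx_and_eqOn n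
    (continuous_const (y := (1 : ℝ))) (fun _ ↦ one_pos) hS hO (hUO.sub contDiffOn_const)
  have hd (x) : ‖1 + g x - U x‖ < 1 := by
    have := hgd x
    rwa [dist_eq_norm, ← sub_add, sub_add_eq_add_sub, add_comm (g x)] at this
  have h0 (x) : 1 + g x ≠ 0 := fun h ↦ by
    have := hd x
    rw [h, zero_sub, norm_neg, norm_unitary_quaternion] at this
    exact lt_irrefl _ this
  have hcoe : (fun x ↦ (unitQuat (1 + g x) : ℍ)) = fun x ↦ ‖1 + g x‖⁻¹ • (1 + g x) :=
    funext fun x ↦ coe_unitQuat (h0 x)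
  refine ⟨fun x ↦ unitQuat (1 + g x), ?_, fun x hx ↦ ?_, fun x hx ↦ ?_, fun x hx ↦ ?_⟩
  · rw [hcoe]
    have h1 : ContDiff ℝ n fun x ↦ 1 + g x := contDiff_const.add hg
    exact ((h1.norm ℝ h0).inv fun x ↦ norm_ne_zero_iff.2 (h0 x)).smul h1
  · have : 1 + g x = U x := by rw [hgS hx]; exact add_sub_cancel _ _
    simp only [this, unitQuat_coe]
  · have : g x = 0 := by
      by_contra h
      exact hgs h (by simp [hx])
    simpa [this] using unitQuat_coe 1
  · have h1 := congrFun hcoe x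
    simp only [hx, Unitary.coe_neg] at h1
    have h2 := norm_pos_iff.2 (h0 x)
    have h3 : 1 + g x - U x = -((‖1 + g x‖ + 1) • (U x : ℍ)) := by
      rw [add_smul, one_smul, ← neg_neg (U x : ℍ), h1, smul_neg, smul_inv_smul₀ h2.ne']
      abel
    have h4 := hd x
    rw [h3, norm_neg, norm_smul, norm_unitary_quaternion, Real.norm_of_nonneg (by linarith)] at h4
    linarith

/-- The real part of a quaternion, as a continuous linear map. -/
noncomputable def reCLM : ℍ →L[ℝ] ℝ :=
  ⟨⟨⟨fun q ↦ q.re, fun _ _ ↦ rfl⟩, fun _ _ ↦ rfl⟩, Quaternion.continuous_re⟩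

/-- The imaginary part of a quaternion, as a continuous linear map. -/
noncomputable def imVecCLM : ℍ →L[ℝ] (Fin 3 → ℝ) :=
  ⟨⟨⟨imVec, fun a b ↦ by ext i; fin_cases i <;> simp [imVec]⟩,
    fun a b ↦ by ext i; fin_cases i <;> simp [imVec]⟩, continuous_imVec⟩

theorem imVec_quat (a : ℝ) (v : Fin 3 → ℝ) : imVec (quat a v) = v := by
  ext i; fin_cases i <;> rfl

open MeasureTheory in
theorem exists_regular_value {F : (Fin 3 → ℝ) → ℍ} (hF : Differentiable ℝ F) :
    ∃ u : unitary ℍ, ∀ x, F x = u → ∀ ξ, ∀ a : ℝ, fderiv ℝ F x ξ = a • (u : ℍ) → ξ = 0 := by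
  borelize ℍ
  set G : ℍ → ℍ := fun y ↦ y.re • F (imVec y)
  set G' : ℍ → ℍ →L[ℝ] ℍ := fun y ↦
    y.re • (fderiv ℝ F (imVec y)).comp imVecCLM + reCLM.smulRight (F (imVec y))
  have hG (y) : HasFDerivAt G (G' y) y :=
    reCLM.hasFDerivAt.smul ((hF (imVec y)).hasFDerivAt.comp y imVecCLM.hasFDerivAt)
  have h0 := addHaar_image_eq_zero_of_det_fderivWithin_eq_zero (s := {y | (G' y).det = 0})
    Measure.addHaar (fun y _ ↦ (hG y).hasFDerivWithinAt) fun y hy ↦ hy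
  obtain ⟨q, hq⟩ : ∃ q, q ∉ G '' {y | (G' y).det = 0} ∪ {0} := by
    by_contra! h
    have h1 : (Measure.addHaar : Measure ℍ) Set.univ = 0 := by
      rw [← Set.eq_univ_of_forall h]
      exact measure_union_null h0 (measure_singleton 0)
    exact NeZero.ne _ (Measure.measure_univ_eq_zero.1 h1)
  rw [Set.mem_union, not_or] at hq
  have hq0 : 0 < ‖q‖ := norm_pos_iff.2 hq.2
  have hu : q = ‖q‖ • (unitQuat q : ℍ) := by rw [coe_unitQuat hq.2, smul_inv_smul₀ hq0.ne']
  refine ⟨unitQuat q, fun x hx ξ a hξ ↦ ?_⟩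
  by_contra hξ0
  refine hq.1 ⟨quat ‖q‖ x, ?_, ?_⟩
  · by_contra hdet
    have hker : G' (quat ‖q‖ x) (quat (-(‖q‖ * a)) ξ) = 0 := by
      change ‖q‖ • fderiv ℝ F (imVec (quat ‖q‖ x)) (imVec (quat (-(‖q‖ * a)) ξ)) +
        (-(‖q‖ * a)) • F (imVec (quat ‖q‖ x)) = 0
      rw [imVec_quat, imVec_quat, hξ, hx]
      module
    have hker' := LinearMap.det_eq_zero_iff_ker_ne_bot.not.1 hdet
    rw [not_not, LinearMap.ker_eq_bot'] at hker'
    have := congrArg imVec (hker' _ hker)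
    rw [imVec_quat] at this
    exact hξ0 (this.trans (map_zero imVecCLM))
  · change ‖q‖ • F (imVec (quat ‖q‖ x)) = q
    rw [imVec_quat, hx, ← hu]

theorem eq_coe_re_of_imVec_eq_zero {q : ℍ} (h : imVec q = 0) : q = (q.re : ℍ) := by
  ext
  · rfl
  · simpa [imVec] using congrFun h 0
  · simpa [imVec] using congrFun h 1
  · simpa [imVec] using congrFun h 2

theorem mem_zpowers_bumpClass (c : π_ 3 (unitary ℍ) 1) : c ∈ Subgroup.zpowers (bumpClass 1) := by
  obtain ⟨F, hF, rfl⟩ := exists_cubeClass_eq c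
  obtain ⟨F', hF', -, hF'1, hFF'⟩ := exists_contDiff_unitary 1 hF.1 isClosed_empty
    mem_nhdsSet_empty contDiffOn_empty
  have hFc : Continuous F' := continuous_induced_rng.2 hF'.continuous
  have hF's : ∀ x : Fin 3 → ℝ, (∃ i, x i ≤ 0 ∨ 1 ≤ x i) → F' x = 1 :=
    fun x hx ↦ hF'1 x (hF.2 x hx)
  have h1 := cubeClass_eq_of_ne_neg hF.1 hFc hF.2 hF's hFF'
  simp only [inv_one, one_mul] at h1
  have hdiff : Differentiable ℝ fun x ↦ (F' x : ℍ) := hF'.differentiable (by simp)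
  obtain ⟨u, hu⟩ := exists_regular_value hdiff
  set e : unitary ℍ := -u⁻¹
  have he : e ≠ -1 := fun he ↦ by
    have hu1 : u = 1 := by simpa [e] using he
    have hev : (fun x ↦ (F' x : ℍ)) =ᶠ[𝓝 2] fun _ ↦ 1 := by
      have h2 : ∀ᶠ x : Fin 3 → ℝ in 𝓝 2, 1 < x 0 :=
        ((continuous_apply 0).tendsto 2).eventually (eventually_gt_nhds (by norm_num))
      filter_upwards [h2] with x hx
      rw [hF's x ⟨0, Or.inr hx.le⟩, OneMemClass.coe_one]
    have := hu 2 (by rw [hu1]; exact hev.eq_of_nhds) 1 0 (by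
      rw [hev.fderiv_eq, fderiv_const_apply, zero_smul]; rfl)
    exact one_ne_zero this
  set L : (Fin 3 → ℝ) → (Fin 3 → ℝ) →L[ℝ] (Fin 3 → ℝ) := fun p ↦
    imVecCLM ∘L (ContinuousLinearMap.mul ℝ ℍ (e : ℍ)) ∘L fderiv ℝ (fun x ↦ (F' x : ℍ)) p
  have hL (p) : HasFDerivAt (fun x ↦ imVec (e * F' x : unitary ℍ)) (L p) p :=
    imVecCLM.hasFDerivAt.comp p ((ContinuousLinearMap.mul ℝ ℍ (e : ℍ)).hasFDerivAt.comp p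
      (hdiff p).hasFDerivAt)
  have heu : (e : ℍ) * u = -1 := by
    have : e * u = -1 := by simp [e]
    simpa [Unitary.coe_neg] using congrArg Subtype.val this
  obtain ⟨δ, hδ0, hδ1, hδe, hmem⟩ := cubeClass_blowUp_mem (W := fun x ↦ e * F' x) (c := e)
    (continuous_const.mul hFc) he (fun x hx ↦ by rw [hF's x hx, mul_one])
    (fun p ↦ LinearMap.toMatrix' (L p : (Fin 3 → ℝ) →ₗ[ℝ] (Fin 3 → ℝ)))
    (fun p hp hdet ↦ by
      obtain ⟨v, hv0, hv⟩ := exists_mulVec_eq_zero_iff.2 hdet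
      rw [LinearMap.toMatrix'_mulVec] at hv
      have hpu : F' p = u := by
        have : e * F' p = e * u := hp.trans (by simp [e])
        exact mul_left_cancel this
      have h3 := eq_coe_re_of_imVec_eq_zero hv
      refine hv0 (hu p (by rw [hpu]) v (-((e : ℍ) * fderiv ℝ (fun x ↦ (F' x : ℍ)) p v).re) ?_)
      refine mul_left_cancel₀ (unitary_quaternion_ne_zero e) (Eq.trans h3 ?_)
      rw [mul_smul_comm, heu, neg_smul_neg, ← Quaternion.coe_one, Quaternion.smul_coe, mul_one]
      rfl)
    (fun p hp ↦ by
      convert hL p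
      ext v : 1
      simp)
  have h2 := cubeClass_eq_of_ne_neg (F := fun x ↦ e * F' x) (F' := fun x ↦ blowUp δ (e * F' x))
    (continuous_const.mul hFc) ((continuous_blowUp hδ0 hδ1).comp (continuous_const.mul hFc))
    (c := e) (c' := 1) (fun x hx ↦ by rw [hF's x hx, mul_one])
    (fun x hx ↦ by rw [hF's x hx, mul_one, hδe])
    fun x h ↦ blowUp_ne_neg hδ0 (e * F' x) (by rw [h, Unitary.coe_neg])
  simp only [inv_mul_cancel_left, inv_one, one_mul] at h2
  rw [h1, h2]
  exact hmem

end Smooth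

section Stokes

open Matrix MeasureTheory

/-- The determinant of four vectors, as a continuous multilinear map. -/
def detMultilinear : ContinuousMultilinearMap ℝ (fun _ : Fin 4 ↦ Fin 4 → ℝ) ℝ :=
  ⟨detRowAlternating.toMultilinearMap, continuous_id.matrix_det⟩

/-- The Leibniz expansion of a determinant of order four. -/
theorem det_of_four (a b c d : Fin 4 → ℝ) : det (of ![a, b, c, d]) =
    a 0 * (b 1 * (c 2 * d 3 - c 3 * d 2) - b 2 * (c 1 * d 3 - c 3 * d 1) +
      b 3 * (c 1 * d 2 - c 2 * d 1)) -
    a 1 * (b 0 * (c 2 * d 3 - c 3 * d 2) - b 2 * (c 0 * d 3 - c 3 * d 0) +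
      b 3 * (c 0 * d 2 - c 2 * d 0)) +
    a 2 * (b 0 * (c 1 * d 3 - c 3 * d 1) - b 1 * (c 0 * d 3 - c 3 * d 0) +
      b 3 * (c 0 * d 1 - c 1 * d 0)) -
    a 3 * (b 0 * (c 1 * d 2 - c 2 * d 1) - b 1 * (c 0 * d 2 - c 2 * d 0) +
      b 2 * (c 0 * d 1 - c 1 * d 0)) := by
  simp [det_succ_row_zero, Fin.sum_univ_succ, Fin.succAbove]
  ring

theorem sum_det_update_cons (A a : Fin 4 → ℝ) (f g : Fin 3 → Fin 4 → ℝ) : ∑ k : Fin 4,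
    det (of (Function.update (Fin.cons A f : Fin 4 → Fin 4 → ℝ) k
      ((Fin.cons a g : Fin 4 → Fin 4 → ℝ) k))) =
    det (of ![a, f 0, f 1, f 2]) + det (of ![A, g 0, f 1, f 2]) +
      det (of ![A, f 0, g 1, f 2]) + det (of ![A, f 0, f 1, g 2]) := by
  have h (u v : Fin 4 → Fin 4 → ℝ) (h0 : u 0 = v 0) (h1 : u 1 = v 1) (h2 : u 2 = v 2)
      (h3 : u 3 = v 3) : det (of u) = det (of v) := by
    rw [show u = v from funext (Fin.forall_fin_succ.2 ⟨h0, Fin.forall_fin_succ.2 ⟨h1,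
      Fin.forall_fin_succ.2 ⟨h2, Fin.forall_fin_one.2 h3⟩⟩⟩)]
  rw [Fin.sum_univ_four]
  exact congrArg₂ _ (congrArg₂ _ (congrArg₂ _ (h _ _ rfl rfl rfl rfl) (h _ _ rfl rfl rfl rfl))
    (h _ _ rfl rfl rfl rfl)) (h _ _ rfl rfl rfl rfl)

theorem det_cons_divergence {A : Fin 4 → ℝ} {p : Fin 4 → Fin 4 → ℝ} (q : Fin 4 → Fin 4 → Fin 4 → ℝ)
    (hq : ∀ j k, q j k = q k j) (hA : A ≠ 0) (hp : ∀ j, p j ⬝ᵥ A = 0) :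
    ∑ i : Fin 4, (-1) ^ (i : ℕ) * ∑ k : Fin 4,
      det (of (Function.update (Fin.cons A fun k ↦ p (i.succAbove k) : Fin 4 → Fin 4 → ℝ) k
        ((Fin.cons (p i) fun k ↦ q (i.succAbove k) i : Fin 4 → Fin 4 → ℝ) k))) = 0 := by
  have hdet : det (of p) = 0 := exists_mulVec_eq_zero_iff.1 ⟨A, hA, funext hp⟩
  have hrow : (of p) = of ![p 0, p 1, p 2, p 3] := by
    ext k; fin_cases k <;> rfl
  rw [hrow, det_of_four] at hdet
  simp only [sum_det_update_cons]
  rw [Fin.sum_univ_four]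
  simp only [show (0 : Fin 4).succAbove 0 = 1 from rfl, show (0 : Fin 4).succAbove 1 = 2 from rfl,
    show (0 : Fin 4).succAbove 2 = 3 from rfl, show (1 : Fin 4).succAbove 0 = 0 from rfl,
    show (1 : Fin 4).succAbove 1 = 2 from rfl, show (1 : Fin 4).succAbove 2 = 3 from rfl,
    show (2 : Fin 4).succAbove 0 = 0 from rfl, show (2 : Fin 4).succAbove 1 = 1 from rfl,
    show (2 : Fin 4).succAbove 2 = 3 from rfl, show (3 : Fin 4).succAbove 0 = 0 from rfl,
    show (3 : Fin 4).succAbove 1 = 1 from rfl, show (3 : Fin 4).succAbove 2 = 2 from rfl,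
    hq 1 0, hq 2 0, hq 3 0, hq 2 1, hq 3 1, hq 3 2, det_of_four,
    show ((0 : Fin 4) : ℕ) = 0 from rfl, show ((1 : Fin 4) : ℕ) = 1 from rfl,
    show ((2 : Fin 4) : ℕ) = 2 from rfl, show ((3 : Fin 4) : ℕ) = 3 from rfl]
  linear_combination 4 * hdet

end Stokes

section Stokes

open Matrix MeasureTheory

/-- The value of the volume form `det (g, dg, dg, dg)` on the coordinate vectors other than the
`i`-th one. -/
noncomputable def faceDet (g : (Fin 4 → ℝ) → Fin 4 → ℝ) (i : Fin 4) (y : Fin 4 → ℝ) : ℝ :=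
  det (of (Fin.cons (g y) fun k : Fin 3 ↦ fderiv ℝ g y (Pi.single (i.succAbove k) 1)))

theorem faceDet_eq_zero {g : (Fin 4 → ℝ) → Fin 4 → ℝ} {y : Fin 4 → ℝ} (h : fderiv ℝ g y = 0)
    (i : Fin 4) : faceDet g i y = 0 :=
  det_eq_zero_of_row_eq_zero 1 fun j ↦ by
    change fderiv ℝ g y _ j = 0
    rw [h]; rfl

theorem hasFDerivAt_cons_partial {g : (Fin 4 → ℝ) → Fin 4 → ℝ} (hg : ContDiff ℝ 2 g) (i : Fin 4)
    (y : Fin 4 → ℝ) : ∃ L : (Fin 4 → ℝ) →L[ℝ] (Fin 4 → Fin 4 → ℝ),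
      HasFDerivAt (fun y ↦ (Fin.cons (g y) fun k : Fin 3 ↦
        fderiv ℝ g y (Pi.single (i.succAbove k) 1) : Fin 4 → Fin 4 → ℝ)) L y ∧
      ∀ v, L v = Fin.cons (fderiv ℝ g y v) fun k : Fin 3 ↦
        fderiv ℝ (fderiv ℝ g) y v (Pi.single (i.succAbove k) 1) := by
  have h1 : Differentiable ℝ g := hg.differentiable (by norm_num)
  have h2 : Differentiable ℝ (fderiv ℝ g) :=
    (hg.fderiv_right (m := 1) (by norm_num)).differentiable (by norm_num)
  refine ⟨ContinuousLinearMap.pi (Fin.cons (fderiv ℝ g y) fun k : Fin 3 ↦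
    (fderiv ℝ (fderiv ℝ g) y).flip (Pi.single (i.succAbove k) 1)), ?_, fun v ↦ ?_⟩
  · refine hasFDerivAt_pi.2 (Fin.cases ?_ fun k ↦ ?_)
    · exact (h1 y).hasFDerivAt
    · exact ((h2 y).hasFDerivAt.clm_apply (hasFDerivAt_const _ y)).congr_fderiv (by ext; simp)
  · ext k
    refine Fin.cases ?_ (fun k ↦ ?_) k <;> rfl

theorem hasFDerivAt_faceDet {g : (Fin 4 → ℝ) → Fin 4 → ℝ} (hg : ContDiff ℝ 2 g) (i : Fin 4)
    (y : Fin 4 → ℝ) : HasFDerivAt (faceDet g i) (fderiv ℝ (faceDet g i) y) y ∧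
      ∀ v, fderiv ℝ (faceDet g i) y v = ∑ k : Fin 4, det (of (Function.update
        (Fin.cons (g y) fun k : Fin 3 ↦ fderiv ℝ g y (Pi.single (i.succAbove k) 1) :
          Fin 4 → Fin 4 → ℝ) k
        ((Fin.cons (fderiv ℝ g y v) fun k : Fin 3 ↦
          fderiv ℝ (fderiv ℝ g) y v (Pi.single (i.succAbove k) 1) : Fin 4 → Fin 4 → ℝ) k))) := by
  obtain ⟨L, hL, hLv⟩ := hasFDerivAt_cons_partial hg i y
  have h : HasFDerivAt (faceDet g i) (detMultilinear.linearDeriv (Fin.cons (g y) fun k : Fin 3 ↦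
      fderiv ℝ g y (Pi.single (i.succAbove k) 1)) ∘L L) y :=
    (detMultilinear.hasFDerivAt _).comp y hL
  refine ⟨h.differentiableAt.hasFDerivAt, fun v ↦ ?_⟩
  rw [h.fderiv, ContinuousLinearMap.comp_apply, ContinuousMultilinearMap.linearDeriv_apply, hLv]
  rfl

theorem sum_fderiv_faceDet {g : (Fin 4 → ℝ) → Fin 4 → ℝ} (hg : ContDiff ℝ 2 g)
    (h1 : ∀ y, g y ⬝ᵥ g y = 1) (y : Fin 4 → ℝ) :
    ∑ i : Fin 4, (-1) ^ (i : ℕ) * fderiv ℝ (faceDet g i) y (Pi.single i 1) = 0 := by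
  have hd : DifferentiableAt ℝ g y := hg.differentiable (by norm_num) y
  have hne : g y ≠ 0 := fun h ↦ by simpa [h] using h1 y
  have hp (v : Fin 4 → ℝ) : fderiv ℝ g y v ⬝ᵥ g y = 0 := by
    have h2 : HasFDerivAt (fun y ↦ g y ⬝ᵥ g y) (∑ k, (g y k • (ContinuousLinearMap.proj k ∘L
        fderiv ℝ g y) + g y k • (ContinuousLinearMap.proj k ∘L fderiv ℝ g y))) y :=
      HasFDerivAt.fun_sum fun k _ ↦ by
        have := (hasFDerivAt_apply k (g y)).comp y hd.hasFDerivAt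
        exact this.mul this
    have h3 : HasFDerivAt (fun y ↦ g y ⬝ᵥ g y) (0 : (Fin 4 → ℝ) →L[ℝ] ℝ) y := by
      simpa only [h1] using hasFDerivAt_const (1 : ℝ) y
    have h4 := congrArg (fun L : (Fin 4 → ℝ) →L[ℝ] ℝ ↦ L v) (h2.unique h3)
    simp [Finset.sum_add_distrib] at h4
    simpa [dotProduct, mul_comm] using h4
  have hq (v w : Fin 4 → ℝ) : fderiv ℝ (fderiv ℝ g) y v w = fderiv ℝ (fderiv ℝ g) y w v :=
    (hg.contDiffAt.isSymmSndFDerivAt (by simp)).eq v w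
  simp only [(hasFDerivAt_faceDet hg _ y).2]
  exact det_cons_divergence (p := fun j ↦ fderiv ℝ g y (Pi.single j 1))
    (fun j k ↦ fderiv ℝ (fderiv ℝ g) y (Pi.single k 1) (Pi.single j 1)) (fun j k ↦ hq _ _) hne
    fun j ↦ hp _

theorem integral_faceDet_eq_zero {g : (Fin 4 → ℝ) → Fin 4 → ℝ} (hg : ContDiff ℝ 2 g)
    (h1 : ∀ y, g y ⬝ᵥ g y = 1)
    (hb : ∀ y, ((∃ i : Fin 3, y i.succ = -1 ∨ y i.succ = 2) ∨ y 0 = 2) → fderiv ℝ g y = 0) :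
    ∫ x in Set.Icc (-1 : Fin 3 → ℝ) 2, faceDet g 0 (Fin.cons (-1) x) = 0 := by
  have hf (i : Fin 4) (y) := (hasFDerivAt_faceDet hg i y).1
  have key := integral_divergence_of_hasFDerivAt_off_countable' (-1 : Fin 4 → ℝ) 2
    (fun _ ↦ by norm_num) (fun i y ↦ (-1) ^ (i : ℕ) * faceDet g i y)
    (fun i y ↦ (-1 : ℝ) ^ (i : ℕ) • fderiv ℝ (faceDet g i) y) ∅ Set.countable_empty
    (fun i ↦ (continuous_const.mul <| continuous_iff_continuousAt.2 fun y ↦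
      (hf i y).continuousAt).continuousOn)
    (fun y _ i ↦ (hf i y).const_mul _) (by simp [sum_fderiv_faceDet hg h1])
  simp only [_root_.smul_apply, smul_eq_mul, sum_fderiv_faceDet hg h1, integral_zero] at key
  have hz (i : Fin 4) (c : ℝ) (hc : c = 2 ∨ i ≠ 0 ∧ c = -1) (x : Fin 3 → ℝ) :
      faceDet g i (i.insertNth c x) = 0 := by
    refine faceDet_eq_zero (hb _ ?_) i
    induction i using Fin.cases with
    | zero => exact Or.inr (by simpa using hc)
    | succ i => exact Or.inl ⟨i, by simpa [or_comm] using hc⟩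
  rw [Fin.sum_univ_succ] at key
  simp only [Pi.ofNat_apply, hz _ _ (Or.inl rfl), Pi.neg_apply,
    hz _ _ (Or.inr ⟨Fin.succ_ne_zero _, rfl⟩), mul_zero, integral_zero, sub_zero,
    Finset.sum_const_zero] at key
  simp only [Fin.val_zero, pow_zero, one_mul, zero_sub, add_zero, zero_eq_neg] at key
  simp only [Fin.insertNth_zero'] at key
  rwa [show (-1 : Fin 4 → ℝ) ∘ Fin.succAbove 0 = -1 from rfl,
    show (2 : Fin 4 → ℝ) ∘ Fin.succAbove 0 = 2 from rfl] at key

end Stokes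

section Jacobian

open Matrix

/-- The coordinates of a quaternion. -/
noncomputable def quatVec : ℍ →L[ℝ] (Fin 4 → ℝ) :=
  (EuclideanSpace.equiv (Fin 4) ℝ : EuclideanSpace ℝ (Fin 4) →L[ℝ] (Fin 4 → ℝ)) ∘L
    (Quaternion.linearIsometryEquivTuple.toContinuousLinearEquiv :
      ℍ →L[ℝ] EuclideanSpace ℝ (Fin 4))

theorem quatVec_apply (q : ℍ) : quatVec q = ![q.re, q.imI, q.imJ, q.imK] := rfl

theorem quatVec_dotProduct_self (q : ℍ) : quatVec q ⬝ᵥ quatVec q = ‖q‖ ^ 2 := by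
  rw [sq, ← Quaternion.normSq_eq_norm_mul_self, Quaternion.normSq_def', quatVec_apply]
  simp [dotProduct, Fin.sum_univ_succ]
  ring

/-- The coordinate density of the volume form pulled back along a quaternion valued map. -/
noncomputable def jacobianDensity (F : (Fin 3 → ℝ) → ℍ) (x : Fin 3 → ℝ) : ℝ :=
  det (of ![quatVec (F x), quatVec (fderiv ℝ F x (Pi.single 0 1)),
    quatVec (fderiv ℝ F x (Pi.single 1 1)), quatVec (fderiv ℝ F x (Pi.single 2 1))])

theorem faceDet_zero_eq {G : (Fin 4 → ℝ) → ℍ} (hG : Differentiable ℝ G) (c : ℝ) (x : Fin 3 → ℝ) :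
    faceDet (fun y ↦ quatVec (G y)) 0 (Fin.cons c x) =
      jacobianDensity (fun x ↦ G (Fin.cons c x)) x := by
  have h1 (y) : HasFDerivAt (fun y ↦ quatVec (G y)) (quatVec ∘L fderiv ℝ G y) y :=
    quatVec.hasFDerivAt.comp y (hG y).hasFDerivAt
  have h2 : HasFDerivAt (fun x : Fin 3 → ℝ ↦ (Fin.cons c x : Fin 4 → ℝ))
      (ContinuousLinearMap.pi (Fin.cons 0 fun k ↦ ContinuousLinearMap.proj k :
        Fin 4 → (Fin 3 → ℝ) →L[ℝ] ℝ)) x := by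
    refine hasFDerivAt_pi'.2 fun i ↦ ?_
    induction i using Fin.cases with
    | zero => exact hasFDerivAt_const _ _
    | succ k => exact hasFDerivAt_apply k x
  have h3 := ((hG _).hasFDerivAt.comp x h2).fderiv
  have h4 (k : Fin 3) : fderiv ℝ (fun x ↦ G (Fin.cons c x)) x (Pi.single k 1) =
      fderiv ℝ G (Fin.cons c x) (Pi.single k.succ 1) := by
    refine (congrArg (fun L : (Fin 3 → ℝ) →L[ℝ] ℍ ↦ L (Pi.single k 1)) h3).trans
      (congrArg (fderiv ℝ G (Fin.cons c x)) (funext (Fin.cases ?_ fun j ↦ ?_)))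
    · simp
    · simp [Pi.single_apply]
  rw [faceDet, jacobianDensity, (h1 _).fderiv, h4, h4, h4]
  congr 2
  funext j
  fin_cases j <;> rfl

theorem jacobianDensity_congr {F F' : (Fin 3 → ℝ) → ℍ} {x : Fin 3 → ℝ} (h : F =ᶠ[𝓝 x] F') :
    jacobianDensity F x = jacobianDensity F' x := by
  rw [jacobianDensity, jacobianDensity, h.fderiv_eq, h.eq_of_nhds]

theorem jacobianDensity_const (q : ℍ) (x : Fin 3 → ℝ) : jacobianDensity (fun _ ↦ q) x = 0 := by
  simp [jacobianDensity, det_of_four]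

theorem continuous_jacobianDensity {F : (Fin 3 → ℝ) → ℍ} (hF : ContDiff ℝ 1 F) :
    Continuous (jacobianDensity F) := by
  have h1 := hF.continuous
  have h2 (v) : Continuous fun x ↦ fderiv ℝ F x v :=
    (hF.continuous_fderiv (by norm_num)).clm_apply continuous_const
  have h3 := h2 (Pi.single 0 1)
  have h4 := h2 (Pi.single 1 1)
  have h5 := h2 (Pi.single 2 1)
  unfold jacobianDensity
  simp only [det_of_four]
  fun_prop

theorem jacobianDensity_smul {r : (Fin 3 → ℝ) → ℝ} {F : (Fin 3 → ℝ) → ℍ} {x : Fin 3 → ℝ}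
    (hr : DifferentiableAt ℝ r x) (hF : DifferentiableAt ℝ F x) :
    jacobianDensity (fun x ↦ r x • F x) x = r x ^ 4 * jacobianDensity F x := by
  simp only [jacobianDensity, fderiv_fun_smul hr hF, det_of_four]
  simp
  ring

theorem jacobianDensity_comp_affine {F : (Fin 3 → ℝ) → ℍ} (hF : Differentiable ℝ F) (s : ℝ)
    (p x : Fin 3 → ℝ) : jacobianDensity (fun x ↦ F (s • (x - p))) x =
      s ^ 3 * jacobianDensity F (s • (x - p)) := by
  have h1 : HasFDerivAt (fun x : Fin 3 → ℝ ↦ s • (x - p))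
      (s • ContinuousLinearMap.id ℝ (Fin 3 → ℝ)) x :=
    ((hasFDerivAt_id x).sub_const p).const_smul s
  have h2 : fderiv ℝ (fun x ↦ F (s • (x - p))) x = _ := ((hF _).hasFDerivAt.comp x h1).fderiv
  simp only [jacobianDensity, h2, det_of_four]
  simp
  ring

theorem contDiff_ballBump {n : ℕ∞} : ContDiff ℝ n ballBump := by
  refine expNegInvGlue.contDiff.comp (contDiff_const.sub ?_)
  unfold nsq
  fun_prop

theorem contDiff_quat {n : ℕ∞} {E : Type*} [NormedAddCommGroup E] [NormedSpace ℝ E]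
    {a : E → ℝ} {v : E → Fin 3 → ℝ} (ha : ContDiff ℝ n a) (hv : ContDiff ℝ n v) :
    ContDiff ℝ n fun x ↦ quat (a x) (v x) := by
  have h : ContDiff ℝ n fun x ↦ WithLp.toLp 2 ![a x, v x 0, v x 1, v x 2] := by
    refine contDiff_euclidean.2 fun i ↦ ?_
    have := contDiff_pi.1 hv
    fin_cases i
    exacts [ha, this 0, this 1, this 2]
  exact (Quaternion.linearIsometryEquivTuple.symm.toContinuousLinearEquiv.contDiff).comp h

end Jacobian

section BumpJacobian

open Matrix

theorem contDiff_bumpNum {n : ℕ∞} : ContDiff ℝ n bumpNum := by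
  have h := contDiff_ballBump (n := n)
  refine contDiff_quat ?_ ?_
  · unfold nsq; fun_prop
  · fun_prop

theorem hasFDerivAt_nsq (v : Fin 3 → ℝ) :
    HasFDerivAt nsq (∑ i, (2 * v i) • (ContinuousLinearMap.proj i : (Fin 3 → ℝ) →L[ℝ] ℝ)) v := by
  have h (i : Fin 3) : HasFDerivAt (fun v : Fin 3 → ℝ ↦ v i ^ 2)
      ((2 * v i) • (ContinuousLinearMap.proj i : (Fin 3 → ℝ) →L[ℝ] ℝ)) v := by
    simpa using (hasFDerivAt_apply (𝕜 := ℝ) i v).pow 2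
  rw [Fin.sum_univ_three]
  exact ((h 0).add (h 1)).add (h 2)

theorem fderiv_ballBump (v w : Fin 3 → ℝ) :
    fderiv ℝ ballBump v w = -(deriv expNegInvGlue (1 - nsq v) * ∑ i, 2 * v i * w i) := by
  have h1 := ((expNegInvGlue.contDiff (n := 1)).differentiable (by norm_num)
    (1 - nsq v)).hasDerivAt.comp_hasFDerivAt v ((hasFDerivAt_nsq v).const_sub 1)
  have h2 : fderiv ℝ ballBump v = _ := h1.fderiv
  simp [h2]

theorem quatVec_fderiv_bumpNum (v w : Fin 3 → ℝ) : quatVec (fderiv ℝ bumpNum v w) =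
    ![(∑ i, 2 * v i * w i) - 2 * ballBump v * fderiv ℝ ballBump v w,
      2 * ballBump v * w 0 + 2 * fderiv ℝ ballBump v w * v 0,
      2 * ballBump v * w 1 + 2 * fderiv ℝ ballBump v w * v 1,
      2 * ballBump v * w 2 + 2 * fderiv ℝ ballBump v w * v 2] := by
  have hb := ((contDiff_ballBump (n := 1)).differentiable (by norm_num) v).hasFDerivAt
  have hN := quatVec.hasFDerivAt.comp v
    ((contDiff_bumpNum (n := 1)).differentiable (by norm_num) v).hasFDerivAt
  have hN' (j : Fin 4) := (hasFDerivAt_apply j _).comp v hN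
  have h0 : HasFDerivAt (fun v ↦ nsq v - ballBump v ^ 2) _ v := (hasFDerivAt_nsq v).sub (hb.pow 2)
  have hi (i : Fin 3) : HasFDerivAt (fun v : Fin 3 → ℝ ↦ 2 * ballBump v * v i) _ v :=
    (hb.const_mul 2).mul (hasFDerivAt_apply (𝕜 := ℝ) i v)
  funext j
  fin_cases j
  · refine (congrArg (fun L : (Fin 3 → ℝ) →L[ℝ] ℝ ↦ L w) ((hN' 0).unique h0)).trans ?_
    simp
  · refine (congrArg (fun L : (Fin 3 → ℝ) →L[ℝ] ℝ ↦ L w) ((hN' 1).unique (hi 0))).trans ?_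
    simp
    ring
  · refine (congrArg (fun L : (Fin 3 → ℝ) →L[ℝ] ℝ ↦ L w) ((hN' 2).unique (hi 1))).trans ?_
    simp
    ring
  · refine (congrArg (fun L : (Fin 3 → ℝ) →L[ℝ] ℝ ↦ L w) ((hN' 3).unique (hi 2))).trans ?_
    simp
    ring

theorem jacobianDensity_bumpNum (v : Fin 3 → ℝ) : jacobianDensity bumpNum v =
    8 * ballBump v ^ 2 * (nsq v + ballBump v ^ 2) *
      (-(2 * deriv expNegInvGlue (1 - nsq v) * nsq v) - ballBump v) := by
  have hN : quatVec (bumpNum v) = ![nsq v - ballBump v ^ 2, 2 * ballBump v * v 0,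
      2 * ballBump v * v 1, 2 * ballBump v * v 2] := rfl
  rw [jacobianDensity, det_of_four, hN]
  simp only [quatVec_fderiv_bumpNum, fderiv_ballBump, Fin.sum_univ_three]
  simp [nsq]
  ring

theorem jacobianDensity_bump (v : Fin 3 → ℝ) : jacobianDensity (fun v ↦ (bump v : ℍ)) v =
    ‖bumpNum v‖⁻¹ ^ 4 * jacobianDensity bumpNum v := by
  have hN : Differentiable ℝ bumpNum := (contDiff_bumpNum (n := 1)).differentiable (by norm_num)
  refine Eq.trans ?_ (jacobianDensity_smul (((hN v).norm ℝ (bumpNum_ne_zero v)).inv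
    (norm_ne_zero_iff.2 (bumpNum_ne_zero v))) (hN v))
  exact congrArg (jacobianDensity · v) (funext fun v ↦ coe_unitQuat (bumpNum_ne_zero v))

theorem contDiff_coe_bump {n : ℕ∞} : ContDiff ℝ n fun v ↦ (bump v : ℍ) := by
  have h : (fun v ↦ (bump v : ℍ)) = fun v ↦ ‖bumpNum v‖⁻¹ • bumpNum v :=
    funext fun v ↦ coe_unitQuat (bumpNum_ne_zero v)
  rw [h]
  exact ((contDiff_bumpNum.norm ℝ bumpNum_ne_zero).inv
    fun v ↦ norm_ne_zero_iff.2 (bumpNum_ne_zero v)).smul contDiff_bumpNum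

theorem jacobianDensity_bump_nonpos (v : Fin 3 → ℝ) :
    jacobianDensity (fun v ↦ (bump v : ℍ)) v ≤ 0 := by
  have h1 : 0 ≤ deriv expNegInvGlue (1 - nsq v) := expNegInvGlue.monotone.deriv_nonneg
  have h2 := mul_nonneg (mul_nonneg zero_le_two h1) (nsq_nonneg v)
  have h3 := nsq_nonneg v
  rw [jacobianDensity_bump, jacobianDensity_bumpNum]
  refine mul_nonpos_of_nonneg_of_nonpos (by positivity)
    (mul_nonpos_of_nonneg_of_nonpos (by positivity) ?_)
  linarith [ballBump_nonneg v]

theorem jacobianDensity_bump_zero : jacobianDensity (fun v ↦ (bump v : ℍ)) 0 < 0 := by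
  have h := ballBump_zero_pos
  have hn : 0 < ‖bumpNum 0‖ := norm_pos_iff.2 (bumpNum_ne_zero 0)
  rw [jacobianDensity_bump, jacobianDensity_bumpNum, nsq_eq_zero.2 rfl]
  have h2 : 0 < ‖bumpNum 0‖⁻¹ ^ 4 * (8 * ballBump 0 ^ 2 * ballBump 0 ^ 2 * ballBump 0) := by
    positivity
  simp only [mul_zero, neg_zero, zero_sub, zero_add]
  linarith

end BumpJacobian

section BumpProduct

open Matrix MeasureTheory

/-- The pointwise product of bumps of scale `s⁻¹` centred at the first `k` points of a sequence. -/
noncomputable def bumpProd (s : ℝ) (p : ℕ → Fin 3 → ℝ) : ℕ → (Fin 3 → ℝ) → unitary ℍ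
  | 0 => 1
  | k + 1 => bumpProd s p k * fun x ↦ bump (s • (x - p k))

variable {s : ℝ} {p : ℕ → Fin 3 → ℝ}

theorem contDiff_bumpProd {n : ℕ∞} (k : ℕ) : ContDiff ℝ n fun x ↦ (bumpProd s p k x : ℍ) := by
  induction k with
  | zero => exact contDiff_const
  | succ k ih =>
    exact ih.mul (contDiff_coe_bump.comp (f := fun x ↦ s • (x - p k)) (by fun_prop))

theorem bump_smul_sub_eventuallyEq_one (hs : 0 ≤ s) {x q : Fin 3 → ℝ} (h : 1 < s * ‖x - q‖) :
    (fun x ↦ bump (s • (x - q))) =ᶠ[𝓝 x] 1 := by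
  have hc : Continuous fun x ↦ s * ‖x - q‖ := by fun_prop
  filter_upwards [hc.continuousAt.eventually (lt_mem_nhds h)] with y hy
  refine bump_eq_one ?_
  rw [norm_smul, Real.norm_of_nonneg hs]
  exact hy.le

/-- Near each point, a product of disjointly supported bumps agrees with at most one of them. -/
theorem bumpProd_local (hs : 0 ≤ s) {k : ℕ}
    (hp : ∀ i < k, ∀ j < k, ∀ x, s * ‖x - p i‖ ≤ 1 → s * ‖x - p j‖ ≤ 1 → i = j)
    (x : Fin 3 → ℝ) :
    ((∀ i < k, 1 < s * ‖x - p i‖) ∧ bumpProd s p k =ᶠ[𝓝 x] 1) ∨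
      ∃ i < k, s * ‖x - p i‖ ≤ 1 ∧ bumpProd s p k =ᶠ[𝓝 x] fun x ↦ bump (s • (x - p i)) := by
  induction k with
  | zero => exact Or.inl ⟨by simp, Filter.EventuallyEq.rfl⟩
  | succ k ih =>
    have ih := ih fun i hi j hj ↦ hp i (by omega) j (by omega)
    rcases lt_or_ge 1 (s * ‖x - p k‖) with h | h
    · have h1 := bump_smul_sub_eventuallyEq_one hs h
      rcases ih with ⟨ha, hb⟩ | ⟨i, hi, hx, hb⟩
      · refine Or.inl ⟨fun i hi ↦ ?_, by simpa [bumpProd] using hb.mul h1⟩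
        rcases Nat.lt_succ_iff_lt_or_eq.1 hi with hi | rfl
        exacts [ha i hi, h]
      · exact Or.inr ⟨i, hi.trans k.lt_succ_self, hx, by simpa [bumpProd] using hb.mul h1⟩
    · refine Or.inr ⟨k, k.lt_succ_self, h, ?_⟩
      rcases ih with ⟨-, hb⟩ | ⟨i, hi, hx, -⟩
      · simpa [bumpProd] using hb.mul (Filter.EventuallyEq.refl (𝓝 x) fun x ↦ bump (s • (x - p k)))
      · exact absurd (hp i (by omega) k k.lt_succ_self x hx h) hi.ne

theorem jacobianDensity_bump_affine (s : ℝ) (q x : Fin 3 → ℝ) :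
    jacobianDensity (fun x ↦ (bump (s • (x - q)) : ℍ)) x =
      s ^ 3 * jacobianDensity (fun v ↦ (bump v : ℍ)) (s • (x - q)) :=
  jacobianDensity_comp_affine ((contDiff_coe_bump (n := 1)).differentiable (by norm_num)) s q x

theorem jacobianDensity_bumpProd_nonpos (hs : 0 ≤ s) {k : ℕ}
    (hp : ∀ i < k, ∀ j < k, ∀ x, s * ‖x - p i‖ ≤ 1 → s * ‖x - p j‖ ≤ 1 → i = j)
    (x : Fin 3 → ℝ) : jacobianDensity (fun x ↦ (bumpProd s p k x : ℍ)) x ≤ 0 := by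
  rcases bumpProd_local hs hp x with ⟨-, h⟩ | ⟨i, -, -, h⟩
  · refine ((jacobianDensity_congr (h.fun_comp Subtype.val)).trans ?_).le
    exact jacobianDensity_const 1 x
  · refine (jacobianDensity_congr (h.fun_comp Subtype.val)).trans_le ?_
    exact (jacobianDensity_bump_affine s (p i) x).trans_le
      (mul_nonpos_of_nonneg_of_nonpos (by positivity) (jacobianDensity_bump_nonpos _))

theorem jacobianDensity_bumpProd_neg (hs : 0 < s) {k : ℕ} (hk : 0 < k)
    (hp : ∀ i < k, ∀ j < k, ∀ x, s * ‖x - p i‖ ≤ 1 → s * ‖x - p j‖ ≤ 1 → i = j) :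
    jacobianDensity (fun x ↦ (bumpProd s p k x : ℍ)) (p 0) < 0 := by
  rcases bumpProd_local hs.le hp (p 0) with ⟨h, -⟩ | ⟨i, hi, hx, h⟩
  · exact absurd (h 0 hk) (by simp)
  · obtain rfl := hp i hi 0 hk (p 0) hx (by simp)
    refine (jacobianDensity_congr (h.fun_comp Subtype.val)).trans_lt ?_
    refine (jacobianDensity_bump_affine s (p 0) (p 0)).trans_lt ?_
    rw [sub_self, smul_zero]
    exact mul_neg_of_pos_of_neg (by positivity) jacobianDensity_bump_zero

/-- A null-homotopic smooth map into the unit quaternions has degree zero. -/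
theorem integral_jacobianDensity_eq_zero {F : (Fin 3 → ℝ) → unitary ℍ} (hF : CubeSupported F)
    (hF2 : ContDiff ℝ 2 fun x ↦ (F x : ℍ)) (h : cubeClass F = 1) :
    ∫ x in Set.Icc (-1 : Fin 3 → ℝ) 2, jacobianDensity (fun x ↦ (F x : ℍ)) x = 0 := by
  rw [← cubeClass_one] at h
  obtain ⟨K, Kc, K0, K1, Kb⟩ := exists_homotopy_of_cubeClass_eq hF .one h
  obtain ⟨G, hG, hGS, hG1, -⟩ := exists_contDiff_unitary 2 (E := Fin 4 → ℝ)
    (U := fun y ↦ K (y 0) fun i ↦ y i.succ) (S := {y | y 0 ≤ -1}) (O := {y | y 0 < 0})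
    (Kc.comp (f := fun y : Fin 4 → ℝ ↦ (y 0, fun i : Fin 3 ↦ y i.succ)) (by fun_prop))
    (isClosed_le (continuous_apply 0) continuous_const)
    ((isOpen_lt (continuous_apply 0) continuous_const).mem_nhdsSet.2 fun y hy ↦
      show y 0 < 0 from (show y 0 ≤ -1 from hy).trans_lt (by norm_num))
    (ContDiffOn.congr (f := fun y : Fin 4 → ℝ ↦ (F fun i ↦ y i.succ : ℍ))
      (hF2.comp (f := fun y : Fin 4 → ℝ ↦ fun i : Fin 3 ↦ y i.succ) (by fun_prop)).contDiffOn
      fun y hy ↦ by rw [K0 _ (le_of_lt hy)])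
  have hd : Differentiable ℝ fun y ↦ (G y : ℍ) := hG.differentiable (by norm_num)
  have hfd {W : Set (Fin 4 → ℝ)} (hW : IsOpen W)
      (h1 : ∀ y ∈ W, K (y 0) (fun i ↦ y i.succ) = 1) (y) (hy : y ∈ W) :
      fderiv ℝ (fun y ↦ quatVec (G y)) y = 0 := by
    have : (fun y ↦ quatVec (G y)) =ᶠ[𝓝 y] fun _ ↦ quatVec 1 := by
      filter_upwards [hW.mem_nhds hy] with z hz
      rw [hG1 z (h1 z hz)]; rfl
    rw [this.fderiv_eq, fderiv_fun_const]; rfl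
  have key := integral_faceDet_eq_zero (g := fun y ↦ quatVec (G y)) (quatVec.contDiff.comp hG)
    (fun y ↦ by rw [quatVec_dotProduct_self, norm_unitary_quaternion, one_pow]) fun y hy ↦ by
      rcases hy with ⟨i, hi | hi⟩ | hy
      · exact hfd (isOpen_lt (continuous_apply i.succ) continuous_const)
          (fun z (hz : z i.succ < 0) ↦ Kb _ _ ⟨i, Or.inl hz.le⟩) y
          (show y i.succ < 0 by rw [hi]; norm_num)
      · exact hfd (isOpen_lt continuous_const (continuous_apply i.succ))
          (fun z (hz : 1 < z i.succ) ↦ Kb _ _ ⟨i, Or.inr hz.le⟩) y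
          (show 1 < y i.succ by rw [hi]; norm_num)
      · exact hfd (isOpen_lt continuous_const (continuous_apply 0))
          (fun z (hz : 1 < z 0) ↦ by rw [K1 _ hz.le]; rfl) y (show 1 < y 0 by rw [hy]; norm_num)
  have hGF (x : Fin 3 → ℝ) : G (Fin.cons (-1) x) = F x := by
    have h1 : G (Fin.cons (-1) x) = K (-1) x := hGS (show (-1 : ℝ) ≤ -1 from le_rfl)
    rw [h1, K0 _ (by norm_num)]
  simpa only [faceDet_zero_eq hd, hGF] using key

theorem cubeClass_bumpProd_ne_one (hs : 0 < s) {k : ℕ} (hk : 0 < k)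
    (hp : ∀ i < k, ∀ j < k, ∀ x, s * ‖x - p i‖ ≤ 1 → s * ‖x - p j‖ ≤ 1 → i = j)
    (hp0 : p 0 ∈ Set.pi Set.univ fun _ : Fin 3 ↦ Set.Ioo (-1 : ℝ) 2)
    (hF : CubeSupported (bumpProd s p k)) : cubeClass (bumpProd s p k) ≠ 1 := by
  intro h
  have h0 := integral_jacobianDensity_eq_zero hF (contDiff_bumpProd k) h
  have hc := continuous_jacobianDensity (contDiff_bumpProd (s := s) (p := p) (n := 1) k)
  set J := jacobianDensity fun x ↦ (bumpProd s p k x : ℍ) with hJ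
  have hn (x) : 0 ≤ -J x := neg_nonneg.2 (jacobianDensity_bumpProd_nonpos hs.le hp x)
  have hpos : 0 < ∫ x in Set.Icc (-1 : Fin 3 → ℝ) 2, -J x := by
    rw [setIntegral_pos_iff_support_of_nonneg_ae (Filter.Eventually.of_forall hn)
      (hc.neg.continuousOn.integrableOn_compact isCompact_Icc)]
    have hU : IsOpen ({x | J x < 0} ∩ Set.pi Set.univ fun _ : Fin 3 ↦ Set.Ioo (-1 : ℝ) 2) :=
      (isOpen_lt hc continuous_const).inter (isOpen_set_pi Set.finite_univ fun _ _ ↦ isOpen_Ioo)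
    refine (hU.measure_pos volume ⟨p 0, jacobianDensity_bumpProd_neg hs hk hp, hp0⟩).trans_le
      (measure_mono fun x hx ↦ ⟨?_, ?_⟩)
    · exact neg_ne_zero.2 (ne_of_lt hx.1)
    · exact ⟨fun i ↦ (hx.2 i trivial).1.le, fun i ↦ (hx.2 i trivial).2.le⟩
  rw [integral_neg, h0, neg_zero] at hpos
  exact lt_irrefl _ hpos

end BumpProduct

section InfiniteOrder

theorem bumpClass_one_pow_ne_one {n : ℕ} (hn : 0 < n) : bumpClass 1 ^ n ≠ 1 := by
  have hn' : (1 : ℝ) ≤ n := by exact_mod_cast hn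
  set s : ℝ := 4 * n with hs
  set p : ℕ → Fin 3 → ℝ := fun k ↦ Fin.cons ((k + 1 / 2) / n) fun _ ↦ 1 / 2 with hp
  have hs0 : 0 < s := by positivity
  have hball (k : ℕ) (hk : k < n) (i : Fin 3) : 1 / s ≤ p k i ∧ p k i + 1 / s ≤ 1 := by
    have hk' : (k : ℝ) + 1 ≤ n := by exact_mod_cast hk
    have hk0 : (0 : ℝ) ≤ k := k.cast_nonneg
    induction i using Fin.cases with
    | zero =>
      simp only [hp, hs, Fin.cons_zero]
      constructor
      · rw [div_le_div_iff₀ (by positivity) (by positivity)]; nlinarith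
      · rw [div_add_div _ _ (by positivity) (by positivity), div_le_one (by positivity)]; nlinarith
    | succ i =>
      have : 1 / s ≤ 1 / 4 := one_div_le_one_div_of_le (by norm_num) (by linarith)
      simp only [hp, Fin.cons_succ]
      constructor <;> linarith
  have hsupp (k : ℕ) (hk : k < n) : CubeSupported fun x ↦ bump (s • (x - p k)) :=
    cubeSupported_bump (by fun_prop) fun x hx ↦ by
      have := le_norm_sub_of_not_mem_cube (hball k hk) hx
      rw [div_le_iff₀' hs0] at this
      rwa [norm_smul, Real.norm_of_nonneg hs0.le]
  have hclass (k : ℕ) (hk : k ≤ n) :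
      CubeSupported (bumpProd s p k) ∧ cubeClass (bumpProd s p k) = bumpClass 1 ^ k := by
    induction k with
    | zero => exact ⟨.one, cubeClass_one⟩
    | succ k ih =>
      obtain ⟨h1, h2⟩ := ih (by omega)
      refine ⟨h1.mul (hsupp k hk), ?_⟩
      rw [bumpProd, cubeClass_mul h1 (hsupp k hk), h2, pow_succ]
      congr 1
      have := cubeClass_bump_affine (A := 1) (by simp) hs0.le (hball k hk) fun v hv ↦ by
        rwa [Matrix.one_mulVec, ← div_le_iff₀' hs0]
      simpa using this
  rw [← (hclass n le_rfl).2]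
  refine cubeClass_bumpProd_ne_one hs0 hn (fun i _ j _ x hi hj ↦ ?_) ?_ (hclass n le_rfl).1
  · have h (k : ℕ) (hk : s * ‖x - p k‖ ≤ 1) : |n * x 0 - (k + 1 / 2)| ≤ 1 / 4 := by
      have h1 : |x 0 - p k 0| ≤ ‖x - p k‖ := norm_le_pi_norm (x - p k) 0
      have h2 : n * x 0 - (k + 1 / 2) = n * (x 0 - p k 0) := by
        simp only [hp, Fin.cons_zero]
        field_simp
      rw [h2, abs_mul, abs_of_pos (by linarith)]
      nlinarith
    have h1 := abs_le.1 (h i hi)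
    have h2 := abs_le.1 (h j hj)
    have h3 : (i : ℝ) < j + 1 := by linarith
    have h4 : (j : ℝ) < i + 1 := by linarith
    norm_cast at h3 h4
    omega
  · intro i _
    have := hball 0 hn i
    have h0 : 0 < 1 / s := by positivity
    constructor <;> linarith

/-- The third homotopy group of the group of unit quaternions is infinite cyclic. -/
noncomputable def intEquivPiThreeUnitQuaternion : Multiplicative ℤ ≃* π_ 3 (unitary ℍ) 1 :=
  MulEquiv.ofBijective (zpowersHom _ (bumpClass 1)) <| by
    constructor
    · rw [injective_iff_map_eq_one]
      intro m hm
      have h : Function.Injective fun k : ℤ ↦ bumpClass 1 ^ k := by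
        rw [injective_zpow_iff_not_isOfFinOrder, isOfFinOrder_iff_pow_eq_one]
        rintro ⟨n, hn, h⟩
        exact bumpClass_one_pow_ne_one hn h
      rw [zpowersHom_apply] at hm
      exact h (hm.trans (zpow_zero _).symm)
    · intro c
      obtain ⟨m, hm⟩ := mem_zpowers_bumpClass c
      exact ⟨Multiplicative.ofAdd m, hm⟩

end InfiniteOrder

/-- The third homotopy group of `Sp(4)` based at the identity is infinite cyclic:
there is a group isomorphism `π₃(Sp(4), 1) ≅ ℤ`. -/
theorem pi3_Sp4_int : Nonempty (π_ 3 (Sp 4) 1 ≃* Multiplicative ℤ) :=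
  ⟨(intEquivPiThreeUnitQuaternion.trans
    (MulEquiv.ofBijective _ (diagUnit_map_bijective (0 : Fin 4)))).symm⟩
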